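/- arXiv:2203.09321 — 5 statements merged into one kernel-verified Lean document; each statement's English description precedes it below -/
import Mathlib

section
/- For all closed terms P, Q over the extended signature Σ(A) = Σ_CP(A) ∪ Σ_SCL(A): CP(¬, ∧❛, ∨❛) ⊢ P = Q if and only if bf(P) = bf(Q). -/
/-- Closed terms over the extended signature Σ(A) = Σ_CP(A) ∪ Σ_SCL(A). -/
inductive Tm (A : Type) : Type
  | T : Tm A
  | F : Tm A
  | at_ : A → Tm A
  | cond : Tm A → Tm A → Tm A → Tm A
  | neg : Tm A → Tm A
  | and : Tm A → Tm A → Tm A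
  | or : Tm A → Tm A → Tm A

/-- CP(¬, ∧❛, ∨❛)-derivability. -/
inductive CPx {A : Type} : Tm A → Tm A → Prop
  | refl (p : Tm A) : CPx p p
  | symm {p q : Tm A} : CPx p q → CPx q p
  | trans {p q r : Tm A} : CPx p q → CPx q r → CPx p r
  | congr_cond {p p' q q' r r' : Tm A} : CPx p p' → CPx q q' → CPx r r' →
      CPx (Tm.cond p q r) (Tm.cond p' q' r')
  | congr_neg {p p' : Tm A} : CPx p p' → CPx (Tm.neg p) (Tm.neg p')
  | congr_and {p p' q q' : Tm A} : CPx p p' → CPx q q' →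
      CPx (Tm.and p q) (Tm.and p' q')
  | congr_or {p p' q q' : Tm A} : CPx p p' → CPx q q' →
      CPx (Tm.or p q) (Tm.or p' q')
  | cp1 (x y : Tm A) : CPx (Tm.cond x Tm.T y) x
  | cp2 (x y : Tm A) : CPx (Tm.cond x Tm.F y) y
  | cp3 (x : Tm A) : CPx (Tm.cond Tm.T x Tm.F) x
  | cp4 (x y z u v : Tm A) :
      CPx (Tm.cond x (Tm.cond y z u) v)
          (Tm.cond (Tm.cond x y v) z (Tm.cond x u v))
  | negdef (x : Tm A) : CPx (Tm.neg x) (Tm.cond Tm.F x Tm.T)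
  | anddef (x y : Tm A) : CPx (Tm.and x y) (Tm.cond y x Tm.F)
  | ordef (x y : Tm A) : CPx (Tm.or x y) (Tm.neg (Tm.and (Tm.neg x) (Tm.neg y)))

/-- The substitution P[T↦Q, F↦R] (defined on basic forms; extended trivially elsewhere). -/
def subst {A : Type} (Q R : Tm A) : Tm A → Tm A
  | Tm.T => Q
  | Tm.F => R
  | Tm.at_ a => Tm.at_ a
  | Tm.cond p1 c p2 => Tm.cond (subst Q R p1) c (subst Q R p2)
  | Tm.neg p => Tm.neg p
  | Tm.and p q => Tm.and p q
  | Tm.or p q => Tm.or p q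

/-- The basic form function bf on Σ(A)-terms. -/
def bf {A : Type} : Tm A → Tm A
  | Tm.T => Tm.T
  | Tm.F => Tm.F
  | Tm.at_ a => Tm.cond Tm.T (Tm.at_ a) Tm.F
  | Tm.cond p q r => subst (bf p) (bf r) (bf q)
  | Tm.neg p => subst Tm.F Tm.T (bf p)       -- = bf (F ◁ p ▷ T)
  | Tm.and p q => subst (bf q) Tm.F (bf p)   -- = bf (q ◁ p ▷ F)
  | Tm.or p q => subst Tm.T (bf q) (bf p)    -- = bf (T ◁ p ▷ q)

theorem subst_T_F {A : Type} (p : Tm A) : subst Tm.T Tm.F p = p := by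
  induction p <;> simp_all [subst]

theorem subst_subst {A : Type} (q r q' r' p : Tm A) :
    subst q r (subst q' r' p) = subst (subst q r q') (subst q r r') p := by
  induction p <;> simp_all [subst]

theorem CPx.bf_eq {A : Type} {p q : Tm A} (h : CPx p q) : bf p = bf q := by
  induction h <;> simp_all [bf, subst, subst_subst, subst_T_F]

/-- Basic forms: terms built from `T` and `F` by conditionals whose conditions are atoms. -/
inductive IsBasicForm {A : Type} : Tm A → Prop
  | T : IsBasicForm Tm.T
  | F : IsBasicForm Tm.F
  | cond {p q : Tm A} (a : A) : IsBasicForm p → IsBasicForm q →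
      IsBasicForm (Tm.cond p (Tm.at_ a) q)

theorem IsBasicForm.subst {A : Type} {p q r : Tm A} (hp : IsBasicForm p)
    (hq : IsBasicForm q) (hr : IsBasicForm r) : IsBasicForm (subst q r p) := by
  induction hp with
  | T => exact hq
  | F => exact hr
  | cond a _ _ ih₁ ih₂ => exact .cond a ih₁ ih₂

theorem isBasicForm_bf {A : Type} (p : Tm A) : IsBasicForm (bf p) := by
  induction p with
  | T => exact .T
  | F => exact .F
  | at_ a => exact .cond a .T .F
  | cond p q r hp hq hr => exact hq.subst hp hr
  | neg p hp => exact hp.subst .F .T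
  | and p q hp hq => exact hp.subst hq .F
  | or p q hp hq => exact hp.subst .T hq

theorem IsBasicForm.cpx_cond_subst {A : Type} {p : Tm A} (hp : IsBasicForm p) (q r : Tm A) :
    CPx (Tm.cond q p r) (_root_.subst q r p) := by
  induction hp with
  | T => exact .cp1 q r
  | F => exact .cp2 q r
  | cond a _ _ ih₁ ih₂ => exact (CPx.cp4 ..).trans (.congr_cond ih₁ (.refl _) ih₂)

theorem cpx_cond_subst_bf {A : Type} {p p' q q' r r' : Tm A}
    (hp : CPx p p') (hq : CPx q (bf q')) (hr : CPx r r') :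
    CPx (Tm.cond p q r) (subst p' r' (bf q')) :=
  (CPx.congr_cond hp hq hr).trans ((isBasicForm_bf q').cpx_cond_subst p' r')

theorem cpx_or_cond {A : Type} (p q : Tm A) : CPx (Tm.or p q) (Tm.cond Tm.T p q) := by
  have neg_neg : CPx (Tm.cond Tm.F (Tm.neg q) Tm.T) q :=
    (CPx.congr_cond (.refl _) (.negdef q) (.refl _)).trans <|
      (CPx.cp4 ..).trans <| (CPx.congr_cond (.cp2 ..) (.refl _) (.cp1 ..)).trans (.cp3 q)
  have and_neg : CPx (Tm.and (Tm.neg p) (Tm.neg q)) (Tm.cond Tm.F p (Tm.neg q)) :=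
    (CPx.anddef ..).trans <| (CPx.congr_cond (.refl _) (.negdef p) (.refl _)).trans <|
      (CPx.cp4 ..).trans (.congr_cond (.cp2 ..) (.refl _) (.cp1 ..))
  exact (CPx.ordef p q).trans <| (CPx.negdef _).trans <|
    (CPx.congr_cond (.refl _) and_neg (.refl _)).trans <|
      (CPx.cp4 ..).trans (.congr_cond (.cp2 ..) (.refl _) neg_neg)

theorem cpx_bf {A : Type} (p : Tm A) : CPx p (bf p) := by
  induction p with
  | T => exact .refl _
  | F => exact .refl _
  | at_ a => exact (CPx.cp3 _).symm
  | cond p q r hp hq hr => exact cpx_cond_subst_bf hp hq hr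
  | neg p hp => exact (CPx.negdef p).trans (cpx_cond_subst_bf (.refl _) hp (.refl _))
  | and p q hp hq => exact (CPx.anddef p q).trans (cpx_cond_subst_bf hq hp (.refl _))
  | or p q hp hq => exact (cpx_or_cond p q).trans (cpx_cond_subst_bf (.refl _) hp hq)

/-- CP(¬, ∧❛, ∨❛) ⊢ P = Q iff bf(P) = bf(Q). -/
theorem cpx_iff_bf_eq {A : Type} (P Q : Tm A) :
    CPx P Q ↔ bf P = bf Q := by
  refine ⟨CPx.bf_eq, fun h => (cpx_bf P).trans ?_⟩
  rw [h]
  exact (cpx_bf Q).symm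
end

section
/- For all closed terms P, Q over the extended signature Σ(A) = Σ_CP(A) ∪ Σ_SCL(A): CPmem(¬, ∧❛, ∨❛) ⊢ P = Q if and only if mbf(P) = mbf(Q). -/
/-- CPmem(¬, ∧❛, ∨❛)-derivability. -/
inductive CPmemX {A : Type} : Tm A → Tm A → Prop
  | refl (p : Tm A) : CPmemX p p
  | symm {p q : Tm A} : CPmemX p q → CPmemX q p
  | trans {p q r : Tm A} : CPmemX p q → CPmemX q r → CPmemX p r
  | congr_cond {p p' q q' r r' : Tm A} : CPmemX p p' → CPmemX q q' → CPmemX r r' →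
      CPmemX (Tm.cond p q r) (Tm.cond p' q' r')
  | congr_neg {p p' : Tm A} : CPmemX p p' → CPmemX (Tm.neg p) (Tm.neg p')
  | congr_and {p p' q q' : Tm A} : CPmemX p p' → CPmemX q q' →
      CPmemX (Tm.and p q) (Tm.and p' q')
  | congr_or {p p' q q' : Tm A} : CPmemX p p' → CPmemX q q' →
      CPmemX (Tm.or p q) (Tm.or p' q')
  | cp1 (x y : Tm A) : CPmemX (Tm.cond x Tm.T y) x
  | cp2 (x y : Tm A) : CPmemX (Tm.cond x Tm.F y) y
  | cp3 (x : Tm A) : CPmemX (Tm.cond Tm.T x Tm.F) x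
  | cp4 (x y z u v : Tm A) :
      CPmemX (Tm.cond x (Tm.cond y z u) v)
             (Tm.cond (Tm.cond x y v) z (Tm.cond x u v))
  | cpmem (x y z u v w : Tm A) :
      CPmemX (Tm.cond x y (Tm.cond z u (Tm.cond v y w)))
             (Tm.cond x y (Tm.cond z u w))
  | negdef (x : Tm A) : CPmemX (Tm.neg x) (Tm.cond Tm.F x Tm.T)
  | anddef (x y : Tm A) : CPmemX (Tm.and x y) (Tm.cond y x Tm.F)
  | ordef (x y : Tm A) : CPmemX (Tm.or x y) (Tm.neg (Tm.and (Tm.neg x) (Tm.neg y)))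

/-- Left-a-reduction ℓ_a (defined on basic forms; extended trivially elsewhere). -/
def la {A : Type} [DecidableEq A] (a : A) : Tm A → Tm A
  | Tm.cond p (Tm.at_ b) q =>
      if b = a then la a p else Tm.cond (la a p) (Tm.at_ b) (la a q)
  | Tm.cond p c q => Tm.cond (la a p) c (la a q)
  | t => t

/-- Right-a-reduction r_a (defined on basic forms; extended trivially elsewhere). -/
def ra {A : Type} [DecidableEq A] (a : A) : Tm A → Tm A
  | Tm.cond p (Tm.at_ b) q =>
      if b = a then ra a q else Tm.cond (ra a p) (Tm.at_ b) (ra a q)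
  | Tm.cond p c q => Tm.cond (ra a p) c (ra a q)
  | t => t

/-- Size of a term (used for termination of `mf`). -/
def sz {A : Type} : Tm A → Nat
  | Tm.cond p q r => sz p + sz q + sz r + 1
  | Tm.neg p => sz p + 1
  | Tm.and p q => sz p + sz q + 1
  | Tm.or p q => sz p + sz q + 1
  | _ => 1

theorem la_sz {A : Type} [DecidableEq A] (a : A) (p : Tm A) : sz (la a p) ≤ sz p := by
  induction p with
  | cond p c q ihp ihc ihq =>
      cases c with
      | at_ b =>
          simp only [la]
          split
          · simp only [sz]; omega
          · simp only [sz]; omega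
      | T => simp only [la, sz]; omega
      | F => simp only [la, sz]; omega
      | cond c1 c2 c3 => simp only [la, sz]; omega
      | neg c1 => simp only [la, sz]; omega
      | and c1 c2 => simp only [la, sz]; omega
      | or c1 c2 => simp only [la, sz]; omega
  | _ => first | simp [la, sz] | (intros; simp [la, sz])

theorem ra_sz {A : Type} [DecidableEq A] (a : A) (p : Tm A) : sz (ra a p) ≤ sz p := by
  induction p with
  | cond p c q ihp ihc ihq =>
      cases c with
      | at_ b =>
          simp only [ra]
          split
          · simp only [sz]; omega
          · simp only [sz]; omega
      | T => simp only [ra, sz]; omega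
      | F => simp only [ra, sz]; omega
      | cond c1 c2 c3 => simp only [ra, sz]; omega
      | neg c1 => simp only [ra, sz]; omega
      | and c1 c2 => simp only [ra, sz]; omega
      | or c1 c2 => simp only [ra, sz]; omega
  | _ => first | simp [ra, sz] | (intros; simp [ra, sz])

/-- The function mf (defined on basic forms; extended trivially elsewhere). -/
def mf {A : Type} [DecidableEq A] : Tm A → Tm A
  | Tm.cond p (Tm.at_ a) q =>
      Tm.cond (mf (la a p)) (Tm.at_ a) (mf (ra a q))
  | Tm.cond p c q => Tm.cond (mf p) c (mf q)
  | t => t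
termination_by t => sz t
decreasing_by
  all_goals simp only [sz]
  all_goals try omega
  all_goals first
    | exact lt_of_le_of_lt (la_sz _ _) (by omega)
    | exact lt_of_le_of_lt (ra_sz _ _) (by omega)

/-- The mem-basic form function. -/
def mbf {A : Type} [DecidableEq A] (P : Tm A) : Tm A := mf (bf P)

namespace CPmemX

variable {A : Type}

theorem swap (x y z : Tm A) :
    CPmemX (Tm.cond x (Tm.cond Tm.F y Tm.T) z) (Tm.cond z y x) :=
  (cp4 _ _ _ _ _).trans (congr_cond (cp2 _ _) (refl _) (cp1 _ _))

theorem congr_mid {x y y' z : Tm A} (h : CPmemX y y') :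
    CPmemX (Tm.cond x y z) (Tm.cond x y' z) :=
  congr_cond (refl _) h (refl _)

theorem congr_left {x x' y z : Tm A} (h : CPmemX x x') :
    CPmemX (Tm.cond x y z) (Tm.cond x' y z) :=
  congr_cond h (refl _) (refl _)

theorem congr_right {x y z z' : Tm A} (h : CPmemX z z') :
    CPmemX (Tm.cond x y z) (Tm.cond x y z') :=
  congr_cond (refl _) (refl _) h

/-- `CPmem` with the repeated condition in the left branch of the inner conditional. -/
theorem cpmem_left (x y z u v w : Tm A) :
    CPmemX (Tm.cond x y (Tm.cond (Tm.cond v y w) u z)) (Tm.cond x y (Tm.cond w u z)) :=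
  (congr_right (swap _ _ _).symm).trans ((cpmem _ _ _ _ _ _).trans (congr_right (swap _ _ _)))

theorem cpmem_contract (x y v w : Tm A) :
    CPmemX (Tm.cond x y (Tm.cond v y w)) (Tm.cond x y w) :=
  (congr_right (cp2 Tm.T _).symm).trans ((cpmem _ _ _ _ _ _).trans (congr_right (cp2 _ _)))

/-- Equivalence of terms in the right branch of a conditional on `y` passes to conditionals. -/
theorem cond_right_congr {y p p' q q' : Tm A} (c : Tm A)
    (hp : ∀ x, CPmemX (Tm.cond x y p) (Tm.cond x y p'))
    (hq : ∀ x, CPmemX (Tm.cond x y q) (Tm.cond x y q')) (x : Tm A) :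
    CPmemX (Tm.cond x y (Tm.cond p c q)) (Tm.cond x y (Tm.cond p' c q')) := by
  have h₁ : CPmemX (Tm.cond x y (Tm.cond p c q)) (Tm.cond x y (Tm.cond p c q')) :=
    (cpmem x y p c Tm.T q).symm.trans
      ((congr_right (congr_right (hq _))).trans (cpmem x y p c Tm.T q'))
  have h₂ : CPmemX (Tm.cond x y (Tm.cond p c q')) (Tm.cond x y (Tm.cond p' c q')) :=
    (cpmem_left x y q' c Tm.T p).symm.trans
      ((congr_right (congr_left (hp _))).trans (cpmem_left x y q' c Tm.T p'))
  exact h₁.trans h₂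

theorem cond_ra [DecidableEq A] (a : A) (t x : Tm A) :
    CPmemX (Tm.cond x (Tm.at_ a) t) (Tm.cond x (Tm.at_ a) (ra a t)) := by
  induction t generalizing x with
  | cond p c q ihp _ ihq =>
    cases c with
    | at_ b =>
      rw [ra]
      split
      · next h => subst h; exact (cpmem_contract _ _ _ _).trans (ihq x)
      · exact cond_right_congr _ ihp ihq x
    | _ =>
      rw [ra]
      · exact cond_right_congr _ ihp ihq x
      · simp
  | _ => exact refl _

theorem cond_la [DecidableEq A] (a : A) (t x : Tm A) :
    CPmemX (Tm.cond t (Tm.at_ a) x) (Tm.cond (la a t) (Tm.at_ a) x) := by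
  suffices h : ∀ x, CPmemX (Tm.cond x (Tm.cond Tm.F (Tm.at_ a) Tm.T) t)
      (Tm.cond x (Tm.cond Tm.F (Tm.at_ a) Tm.T) (la a t)) from
    (swap _ _ _).symm.trans ((h x).trans (swap _ _ _))
  clear x
  intro x
  induction t generalizing x with
  | cond p c q ihp _ ihq =>
    cases c with
    | at_ b =>
      rw [la]
      split
      · next h =>
        subst h
        exact (congr_right (swap _ _ _).symm).trans ((cpmem_contract _ _ _ _).trans (ihp x))
      · exact cond_right_congr _ ihp ihq x
    | _ =>
      rw [la]
      · exact cond_right_congr _ ihp ihq x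
      · simp
  | _ => exact refl _

theorem mf_self [DecidableEq A] (t : Tm A) : CPmemX t (mf t) := by
  induction t using mf.induct with
  | case1 p a q ihp ihq =>
    rw [mf]
    exact (cond_la _ _ _).trans ((cond_ra _ _ _).trans (congr_cond ihp (refl _) ihq))
  | case2 p c q hc ihp ihq =>
    rw [mf]
    · exact congr_cond ihp (refl _) ihq
    · exact hc
  | case3 t h₁ h₂ =>
    rw [mf]
    · exact refl _
    · exact h₁
    · exact h₂

end CPmemX

/-- Basic forms: binary trees with atoms as internal nodes and `T`, `F` as leaves. -/
inductive IsBasic {A : Type} : Tm A → Prop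
  | T : IsBasic Tm.T
  | F : IsBasic Tm.F
  | cond {p q : Tm A} (a : A) : IsBasic p → IsBasic q → IsBasic (Tm.cond p (Tm.at_ a) q)

namespace IsBasic

variable {A : Type}

theorem subst {q r p : Tm A} (hp : IsBasic p) (hq : IsBasic q) (hr : IsBasic r) :
    IsBasic (subst q r p) := by
  induction hp with
  | T => exact hq
  | F => exact hr
  | cond a _ _ ih₁ ih₂ => exact ih₁.cond a ih₂

theorem bf (p : Tm A) : IsBasic (bf p) := by
  induction p with
  | T => exact T
  | F => exact F
  | at_ a => exact T.cond a F
  | cond p q r ihp ihq ihr => exact ihq.subst ihp ihr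
  | neg p ih => exact ih.subst F T
  | and p q ihp ihq => exact ihp.subst ihq F
  | or p q ihp ihq => exact ihp.subst T ihq

theorem la [DecidableEq A] (a : A) {p : Tm A} (hp : IsBasic p) : IsBasic (la a p) := by
  induction hp with
  | T => exact T
  | F => exact F
  | cond b _ _ ih₁ ih₂ =>
    rw [_root_.la]
    split
    · exact ih₁
    · exact ih₁.cond b ih₂

theorem ra [DecidableEq A] (a : A) {p : Tm A} (hp : IsBasic p) : IsBasic (ra a p) := by
  induction hp with
  | T => exact T
  | F => exact F
  | cond b _ _ ih₁ ih₂ =>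
    rw [_root_.ra]
    split
    · exact ih₂
    · exact ih₁.cond b ih₂

theorem subst_equiv_cond {p : Tm A} (hp : IsBasic p) (q r : Tm A) :
    CPmemX (_root_.subst q r p) (Tm.cond q p r) := by
  induction hp with
  | T => exact (CPmemX.cp1 _ _).symm
  | F => exact (CPmemX.cp2 _ _).symm
  | cond a _ _ ih₁ ih₂ =>
    exact (CPmemX.congr_cond ih₁ (.refl _) ih₂).trans (CPmemX.cp4 _ _ _ _ _).symm

end IsBasic

namespace CPmemX

variable {A : Type}

theorem or_equiv_cond (p q : Tm A) : CPmemX (Tm.or p q) (Tm.cond Tm.T p q) := by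
  have h : CPmemX (Tm.and (Tm.neg p) (Tm.neg q)) (Tm.cond Tm.F p (Tm.neg q)) :=
    (anddef _ _).trans ((congr_mid (negdef _)).trans (swap _ _ _))
  have hq : CPmemX (Tm.cond Tm.F (Tm.neg q) Tm.T) q :=
    (congr_mid (negdef _)).trans ((swap _ _ _).trans (cp3 _))
  exact (ordef _ _).trans ((negdef _).trans ((congr_mid h).trans
    ((cp4 _ _ _ _ _).trans (congr_cond (cp2 _ _) (refl _) hq))))

theorem bf_self (p : Tm A) : CPmemX p (bf p) := by
  induction p with
  | T => exact refl _
  | F => exact refl _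
  | at_ a => exact (cp3 _).symm
  | cond p q r ihp ihq ihr =>
    exact (congr_cond ihp ihq ihr).trans ((IsBasic.bf q).subst_equiv_cond _ _).symm
  | neg p ih =>
    exact (negdef p).trans ((congr_mid ih).trans ((IsBasic.bf p).subst_equiv_cond _ _).symm)
  | and p q ihp ihq =>
    exact (anddef p q).trans ((congr_cond ihq ihp (refl _)).trans
      ((IsBasic.bf p).subst_equiv_cond _ _).symm)
  | or p q ihp ihq =>
    exact (or_equiv_cond p q).trans ((congr_cond (refl _) ihp ihq).trans
      ((IsBasic.bf p).subst_equiv_cond _ _).symm)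

theorem mbf_self [DecidableEq A] (p : Tm A) : CPmemX p (mbf p) :=
  (bf_self p).trans (mf_self _)

end CPmemX

section Evaluation

variable {A : Type} [DecidableEq A]

/-- Memorizing evaluation of a term in continuation-passing style: an atom that has already been
evaluated keeps its value, any other atom branches and has its value recorded. -/
def eval : Tm A → (Bool → (A → Option Bool) → Tm A) → (A → Option Bool) → Tm A
  | Tm.T, k, s => k true s
  | Tm.F, k, s => k false s
  | Tm.at_ a, k, s =>
    match s a with
    | some b => k b s
    | none => Tm.cond (k true (Function.update s a (some true))) (Tm.at_ a)
        (k false (Function.update s a (some false)))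
  | Tm.cond p q r, k, s => eval q (fun b s' => if b then eval p k s' else eval r k s') s
  | Tm.neg p, k, s => eval p (fun b s' => k (!b) s') s
  | Tm.and p q, k, s => eval p (fun b s' => if b then eval q k s' else k false s') s
  | Tm.or p q, k, s => eval p (fun b s' => if b then k true s' else eval q k s') s

/-- `t` is an extension of the partial valuation `s`. -/
def Extends (s t : A → Option Bool) : Prop := ∀ a b, s a = some b → t a = some b

theorem extends_update {s : A → Option Bool} {a : A} (h : s a = none) (o : Option Bool) :
    Extends s (Function.update s a o) := by
  intro c b hc
  rw [Function.update_of_ne, hc]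
  rintro rfl
  simp [h] at hc

/-- In every extension of `s`, the term `y` evaluates to `b` without consulting a new atom. -/
def Determined (y : Tm A) (b : Bool) (s : A → Option Bool) : Prop :=
  ∀ t, Extends s t → ∀ k, eval y k t = k b t

theorem Determined.mono {y : Tm A} {b : Bool} {s t : A → Option Bool} (h : Determined y b s)
    (hst : Extends s t) : Determined y b t :=
  fun u hu => h u fun a c hc => hu a c (hst a c hc)

/-- Evaluation passes to its continuation only states extending the initial one and in which the
evaluated term is determined. -/
theorem eval_congr (y : Tm A) {k k' : Bool → (A → Option Bool) → Tm A} {s : A → Option Bool}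
    (h : ∀ b t, Extends s t → Determined y b t → k b t = k' b t) :
    eval y k s = eval y k' s := by
  induction y generalizing k k' s with
  | T => exact h _ _ (fun _ _ => id) fun _ _ _ => rfl
  | F => exact h _ _ (fun _ _ => id) fun _ _ _ => rfl
  | at_ a =>
    have hdet : ∀ b t, t a = some b → Determined (Tm.at_ a) b t := by
      intro b t ht u hu k
      simp [eval, hu a b ht]
    simp only [eval]
    split
    · next b hb => exact h b s (fun _ _ => id) (hdet b s hb)
    · next hs =>
      rw [h true _ (extends_update hs _) (hdet _ _ (by simp)),
        h false _ (extends_update hs _) (hdet _ _ (by simp))]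
  | cond p q r ihp ihq ihr =>
    refine ihq fun b t ht hq => ?_
    cases b
    · refine ihr fun c u hu hr => h c u (fun a d hd => hu a d (ht a d hd)) fun v hv k => ?_
      simp [eval, hq.mono hu v hv, hr v hv]
    · refine ihp fun c u hu hp => h c u (fun a d hd => hu a d (ht a d hd)) fun v hv k => ?_
      simp [eval, hq.mono hu v hv, hp v hv]
  | neg p ih =>
    refine ih fun b t ht hp => h _ _ ht fun v hv k => ?_
    simp [eval, hp v hv]
  | and p q ihp ihq =>
    refine ihp fun b t ht hp => ?_
    cases b
    · refine h _ _ ht fun v hv k => ?_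
      simp [eval, hp v hv]
    · refine ihq fun c u hu hq => h c u (fun a d hd => hu a d (ht a d hd)) fun v hv k => ?_
      simp [eval, hp.mono hu v hv, hq v hv]
  | or p q ihp ihq =>
    refine ihp fun b t ht hp => ?_
    cases b
    · refine ihq fun c u hu hq => h c u (fun a d hd => hu a d (ht a d hd)) fun v hv k => ?_
      simp [eval, hp.mono hu v hv, hq v hv]
    · refine h _ _ ht fun v hv k => ?_
      simp [eval, hp v hv]

theorem CPmemX.eval_eq {p q : Tm A} (h : CPmemX p q) : eval p = eval q := by
  induction h with
  | refl => rfl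
  | symm _ ih => exact ih.symm
  | trans _ _ ih₁ ih₂ => exact ih₁.trans ih₂
  | congr_cond _ _ _ ih₁ ih₂ ih₃ => funext k s; simp only [eval, ih₁, ih₂, ih₃]
  | congr_neg _ ih => funext k s; simp only [eval, ih]
  | congr_and _ _ ih₁ ih₂ => funext k s; simp only [eval, ih₁, ih₂]
  | congr_or _ _ ih₁ ih₂ => funext k s; simp only [eval, ih₁, ih₂]
  | cp1 => rfl
  | cp2 => rfl
  | cp3 x =>
    funext k s
    exact eval_congr x fun b t _ _ => by cases b <;> rfl
  | cp4 x y z u v =>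
    funext k s
    exact eval_congr z fun b t _ _ => by cases b <;> rfl
  | cpmem x y z u v w =>
    funext k s
    refine eval_congr y fun b t _ hy => ?_
    cases b
    · refine eval_congr u fun c t' ht' _ => ?_
      cases c
      · exact hy t' ht' _
      · rfl
    · rfl
  | negdef x =>
    funext k s
    exact eval_congr x fun b t _ _ => by cases b <;> rfl
  | anddef x y =>
    funext k s
    exact eval_congr x fun b t _ _ => by cases b <;> rfl
  | ordef x y =>
    funext k s
    refine eval_congr x fun b t _ _ => ?_
    cases b
    · exact eval_congr y fun c t' _ _ => by cases c <;> rfl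
    · rfl

/-- The continuation that returns the obtained truth value as a constant. -/
def leaf (b : Bool) (_ : A → Option Bool) : Tm A := if b then Tm.T else Tm.F

theorem eval_la (a : A) {t : Tm A} (ht : IsBasic t) (s : A → Option Bool) :
    eval (la a t) leaf s = eval t leaf (Function.update s a (some true)) := by
  induction ht generalizing s with
  | T => rfl
  | F => rfl
  | cond b _ _ ih₁ ih₂ =>
    by_cases h : b = a
    · subst h
      simp [la, eval, ih₁]
    · simp only [la, if_neg h, eval, Function.update_of_ne h]
      cases s b with
      | none => simp [ih₁, ih₂, Function.update_comm h]
      | some c => cases c <;> simp [ih₁, ih₂]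

theorem eval_ra (a : A) {t : Tm A} (ht : IsBasic t) (s : A → Option Bool) :
    eval (ra a t) leaf s = eval t leaf (Function.update s a (some false)) := by
  induction ht generalizing s with
  | T => rfl
  | F => rfl
  | cond b _ _ ih₁ ih₂ =>
    by_cases h : b = a
    · subst h
      simp [ra, eval, ih₂]
    · simp only [ra, if_neg h, eval, Function.update_of_ne h]
      cases s b with
      | none => simp [ih₁, ih₂, Function.update_comm h]
      | some c => cases c <;> simp [ih₁, ih₂]

theorem mf_eq_eval {t : Tm A} (ht : IsBasic t) : mf t = eval t leaf fun _ => none := by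
  induction t using mf.induct with
  | case1 p a q ihp ihq =>
    cases ht with
    | cond _ hp hq =>
      rw [mf, ihp (hp.la a), ihq (hq.ra a), eval_la a hp, eval_ra a hq]
      rfl
  | case2 p c q hc =>
    cases ht with
    | cond a => exact (hc a rfl).elim
  | case3 t h₁ h₂ =>
    cases ht with
    | T => rw [mf] <;> simp [eval, leaf]
    | F => rw [mf] <;> simp [eval, leaf]
    | cond a => exact (h₂ _ _ _ rfl).elim

theorem mbf_eq_eval (p : Tm A) : mbf p = eval p leaf fun _ => none := by
  rw [mbf, mf_eq_eval (IsBasic.bf p), (CPmemX.bf_self p).eval_eq]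

end Evaluation

/-- CPmem(¬, ∧❛, ∨❛) ⊢ P = Q if and only if mbf(P) = mbf(Q). -/
theorem cpmemx_iff_mbf_eq {A : Type} [DecidableEq A] (P Q : Tm A) :
    CPmemX P Q ↔ mbf P = mbf Q := by
  constructor
  · intro h
    rw [mbf_eq_eval, mbf_eq_eval, h.eval_eq]
  · intro h
    have hP := CPmemX.mbf_self P
    rw [h] at hP
    exact hP.trans (CPmemX.mbf_self Q).symm
end

section
/- Duality principle for EqMSCLℓIℓX: for all terms s, t over Σ_SCLℓIℓX(A), EqMSCLℓIℓX ⊢ s = t if and only if EqMSCLℓIℓX ⊢ s^dl = t^dl. -/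
/-- Terms over Σ_SCLℓIℓX(A): variables, T, F, ¬, ∧❛, ∨❛, ↔❛, ⊕❛. -/
inductive XTerm : Type
  | var : Nat → XTerm
  | T : XTerm
  | F : XTerm
  | neg : XTerm → XTerm
  | and : XTerm → XTerm → XTerm
  | or : XTerm → XTerm → XTerm
  | iff : XTerm → XTerm → XTerm
  | xor : XTerm → XTerm → XTerm

/-- Derivability from EqMSCLℓIℓX in equational logic (axioms are taken as schemes,
so closure under substitution is built in). -/
inductive DerivLIX : XTerm → XTerm → Prop
  | refl (p : XTerm) : DerivLIX p p
  | symm {p q : XTerm} : DerivLIX p q → DerivLIX q p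
  | trans {p q r : XTerm} : DerivLIX p q → DerivLIX q r → DerivLIX p r
  | congr_neg {p p' : XTerm} : DerivLIX p p' → DerivLIX (XTerm.neg p) (XTerm.neg p')
  | congr_and {p p' q q' : XTerm} : DerivLIX p p' → DerivLIX q q' →
      DerivLIX (XTerm.and p q) (XTerm.and p' q')
  | congr_or {p p' q q' : XTerm} : DerivLIX p p' → DerivLIX q q' →
      DerivLIX (XTerm.or p q) (XTerm.or p' q')
  | congr_iff {p p' q q' : XTerm} : DerivLIX p p' → DerivLIX q q' →
      DerivLIX (XTerm.iff p q) (XTerm.iff p' q')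
  | congr_xor {p p' q q' : XTerm} : DerivLIX p p' → DerivLIX q q' →
      DerivLIX (XTerm.xor p q) (XTerm.xor p' q')
  | ax_or (x y : XTerm) :
      DerivLIX (XTerm.or x y) (XTerm.neg (XTerm.and (XTerm.neg x) (XTerm.neg y)))
  | ax_abs (x y : XTerm) : DerivLIX (XTerm.and x (XTerm.or x y)) x
  | ax_assoc (x y z : XTerm) :
      DerivLIX (XTerm.and (XTerm.and x y) z) (XTerm.and x (XTerm.and y z))
  | ax_tx (x : XTerm) : DerivLIX (XTerm.iff XTerm.T x) x
  | ax_xf (x : XTerm) : DerivLIX (XTerm.iff x XTerm.F) (XTerm.neg x)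
  | ax_andiff (x y z : XTerm) :
      DerivLIX (XTerm.iff (XTerm.and x y) z)
               (XTerm.or (XTerm.and x (XTerm.iff y z))
                         (XTerm.and (XTerm.neg x) (XTerm.neg z)))
  | ax_xordef (x y : XTerm) : DerivLIX (XTerm.xor x y) (XTerm.iff x (XTerm.neg y))

/-- The duality mapping on Σ_SCLℓIℓX(A)-terms. -/
def dl : XTerm → XTerm
  | XTerm.var n => XTerm.var n
  | XTerm.T => XTerm.F
  | XTerm.F => XTerm.T
  | XTerm.neg p => XTerm.neg (dl p)
  | XTerm.and p q => XTerm.or (dl p) (dl q)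
  | XTerm.or p q => XTerm.and (dl p) (dl q)
  | XTerm.iff p q => XTerm.xor (dl p) (dl q)
  | XTerm.xor p q => XTerm.iff (dl p) (dl q)

/-- The quotient structure axiomatized by EqMSCLℓIℓX, with `∧❛` written as multiplication, `¬` as
complement, `T` and `F` as `1` and `0`, and the definable `∨❛` and `⊕❛` eliminated. -/
class LIXAlgebra (α : Type*) extends Semigroup α, Compl α, One α, Zero α where
  /-- The left-sequential biconditional. -/
  liff : α → α → α
  mul_or_self (x y : α) : x * (xᶜ * yᶜ)ᶜ = x
  one_liff (x : α) : liff 1 x = x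
  liff_zero (x : α) : liff x 0 = xᶜ
  mul_liff (x y z : α) : liff (x * y) z = ((x * liff y z)ᶜ * (xᶜ * zᶜ)ᶜ)ᶜ

namespace LIXAlgebra

local infix:65 "⟷" => LIXAlgebra.liff

variable {α : Type*} [LIXAlgebra α]

section Involution

theorem compl_one : (1 : α)ᶜ = 0 := by rw [← liff_zero, one_liff]

theorem mul_compl_compl_self (x : α) : x * xᶜᶜ = x := by
  simpa only [mul_or_self] using mul_or_self x (xᶜᶜ * xᶜ)

theorem mul_compl_compl_mul (x y : α) : x * (xᶜᶜ * y) = x * y := by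
  rw [← mul_assoc, mul_compl_compl_self]

theorem one_mul_compl_zero : (1 : α) * 0ᶜ = 1 := by
  simpa only [compl_one] using mul_compl_compl_self (1 : α)

theorem exists_eq_compl (x : α) : ∃ y : α, x = yᶜ := by
  have h := mul_liff 1 (0ᶜ) x
  rw [one_mul_compl_zero, one_liff] at h
  exact ⟨_, h⟩

theorem mul_compl_compl_mul_self (x y : α) : x * (xᶜ * y)ᶜ = x := by
  obtain ⟨z, rfl⟩ := exists_eq_compl y
  exact mul_or_self x z

theorem compl_mul (x y : α) : (x * y)ᶜ = ((x * yᶜ)ᶜ * (xᶜ * 0ᶜ)ᶜ)ᶜ := by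
  simpa only [liff_zero] using mul_liff x y 0

theorem mul_one_liff (x y : α) : (x * 1) ⟷ y = ((x * y)ᶜ * (xᶜ * yᶜ)ᶜ)ᶜ := by
  rw [mul_liff, one_liff]

theorem compl_mul_congr_right (x : α) {y z : α} (h : yᶜ = zᶜ) : (x * y)ᶜ = (x * z)ᶜ := by
  rw [compl_mul x y, compl_mul x z, h]

theorem mul_compl_mul_compl_mul (x y : α) : x * (yᶜ * (x * y)ᶜ) = x * yᶜ := by
  rw [← mul_assoc, compl_mul x y, mul_compl_compl_mul_self]

theorem mul_compl_mul_compl_self (x : α) : x * (x * xᶜ)ᶜ = x := by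
  rw [← mul_compl_compl_mul x, mul_compl_mul_compl_mul, mul_compl_compl_self]

theorem one_mul_compl_zero_mul (x : α) : (1 : α) * (0 * x)ᶜ = 1 := by
  simpa only [compl_one] using mul_compl_compl_mul_self (1 : α) x

theorem compl_eq_compl_zero_of_one_mul {x : α} (h : 1 * xᶜ = 1) : (1 * x)ᶜ = 0ᶜ := by
  rw [compl_mul, h, compl_one, mul_compl_mul_compl_self]

theorem compl_zero_mul_compl : (0ᶜ * (0 * 0ᶜ)ᶜ : α)ᶜ = 0 := by
  have h : (1 : α) * 0ᶜᶜᶜ = 1 := by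
    have h := mul_compl_compl_mul (1 : α) 0ᶜᶜᶜ
    rwa [compl_one, mul_compl_compl_self, one_mul_compl_zero, eq_comm] at h
  have h' := compl_mul (1 : α) 0ᶜ
  rw [one_mul_compl_zero, compl_one, compl_eq_compl_zero_of_one_mul h] at h'
  exact h'.symm

theorem zero_mul_zero : (0 : α) * 0 = 0 := by
  simpa only [compl_zero_mul_compl] using mul_compl_compl_mul_self (0 : α) (0 * 0ᶜ)ᶜ

theorem compl_one_mul_one_mul_zero_mul (x : α) : ((1 : α) * (1 * (0 * x)))ᶜ = 0ᶜ := by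
  apply compl_eq_compl_zero_of_one_mul
  have h := mul_compl_mul_compl_mul (1 : α) (0 * x)
  rwa [← mul_assoc, one_mul_compl_zero_mul] at h

theorem compl_compl_zero_mul_compl : (0ᶜ * (0ᶜ * 0ᶜ)ᶜ : α)ᶜ = 0ᶜ := by
  have h := compl_mul ((1 : α) * (1 * (0 * 1))) 1
  simp only [mul_assoc, compl_one_mul_one_mul_zero_mul] at h
  exact h.symm

theorem zero_mul_compl_zero : (0 : α) * 0ᶜ = 0 := by
  simpa only [compl_compl_zero_mul_compl] using mul_compl_compl_mul_self (0 : α) (0ᶜ * 0ᶜ)ᶜ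

theorem compl_compl_zero_mul_self : (0ᶜ * 0ᶜ : α)ᶜ = 0 := by
  simpa only [zero_mul_compl_zero] using compl_zero_mul_compl (α := α)

theorem compl_compl_zero_mul_zero : (0ᶜ * 0 : α)ᶜ = 0ᶜ := by
  simpa only [compl_compl_zero_mul_self] using compl_compl_zero_mul_compl (α := α)

theorem compl_mul_one_eq (x : α) : (x * 1)ᶜ = ((x * 0)ᶜ * (xᶜ * 0ᶜ)ᶜ)ᶜ := by
  rw [← mul_one_liff, liff_zero]

theorem compl_compl_zero : (0 : α)ᶜᶜ = 0 := by
  have h₁ : (0ᶜ * 1 : α)ᶜ = 0ᶜᶜ := by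
    rw [compl_mul_one_eq, compl_compl_zero_mul_zero, mul_compl_compl_mul_self]
  have h₂ : (0ᶜ * (0ᶜ * 0ᶜ) : α)ᶜ = (0ᶜ * 1)ᶜ := by
    rw [compl_mul, compl_compl_zero_mul_self, compl_mul_one_eq]
  have h₃ : (0ᶜ * (0ᶜ * 0ᶜ) : α) = 0ᶜ * 0ᶜ := by
    simpa only [compl_compl_zero_mul_self, mul_assoc] using mul_compl_compl_self (0ᶜ * 0ᶜ : α)
  rw [← h₁, ← h₂, h₃, compl_compl_zero_mul_self]

theorem compl_mul_compl_zero (x : α) : (x * 0ᶜ)ᶜ = (x * 1)ᶜ := by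
  rw [compl_mul, compl_compl_zero, compl_mul_one_eq]

theorem compl_zero_mul (x : α) : (0 * x)ᶜ = 0ᶜ := by
  have h : 0 * (0 * x)ᶜ = 0 := by
    have h := mul_compl_mul_compl_mul 0 (0ᶜ * x)
    rw [← mul_assoc, mul_compl_compl_mul_self, ← mul_assoc, zero_mul_compl_zero] at h
    exact h
  have h' := compl_mul 0 (0 * x)
  rwa [h, ← mul_assoc, zero_mul_zero, compl_compl_zero_mul_compl] at h'

theorem compl_mul_self (x : α) : (x * x)ᶜ = xᶜ := by
  have h₁ : (x * xᶜᶜᶜᶜ) = x := by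
    have h := mul_compl_compl_mul x xᶜᶜᶜᶜ
    rwa [mul_compl_compl_self, mul_compl_compl_self, eq_comm] at h
  have h₂ : (x * xᶜᶜᶜ)ᶜ = (x * xᶜ)ᶜ := by
    rw [compl_mul, h₁, compl_mul x xᶜ, mul_compl_compl_self]
  rw [compl_mul, ← h₂, ← compl_mul, mul_compl_compl_self]

theorem compl_mul_one (x : α) : (x * 1)ᶜ = xᶜ := by
  have h₁ : (x * (xᶜ * 1))ᶜ = (x * xᶜ)ᶜ := by
    rw [compl_mul, mul_compl_compl_mul_self, compl_mul x xᶜ, mul_compl_compl_self]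
  have h₂ : x * ((xᶜ * 1ᶜ)ᶜ * (xᶜᶜ * 0ᶜ)ᶜ) = x * (xᶜᶜ * 1)ᶜ := by
    rw [← mul_assoc, mul_compl_compl_mul_self, compl_mul_compl_zero]
  have h₃ : (x * (xᶜᶜ * 1)ᶜ)ᶜ = (x * xᶜ)ᶜ := by
    rw [← h₁, ← h₂]
    exact compl_mul_congr_right x (compl_mul xᶜ 1).symm
  rw [← mul_compl_compl_mul x, compl_mul, h₃, ← compl_mul, compl_mul_self]

theorem compl_mul_eq (x y : α) : (x * y)ᶜ = ((x * yᶜ)ᶜ * xᶜᶜ)ᶜ := by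
  rw [compl_mul, compl_mul_compl_zero, compl_mul_one]

theorem mul_compl_mul_zero (x : α) : x * (x * 0)ᶜ = x := by
  rw [compl_mul_eq, compl_mul_compl_zero, compl_mul_one, mul_compl_compl_mul_self]

theorem mul_one_liff_one (x : α) : (x * 1) ⟷ 1 = xᶜᶜ := by
  rw [mul_one_liff, compl_one, compl_mul_one, mul_compl_mul_zero]

theorem one_mul_liff (x y : α) : (1 * x) ⟷ y = (1 * (x ⟷ y))ᶜᶜ := by
  rw [mul_liff, compl_one, compl_zero_mul, compl_mul_compl_zero, compl_mul_one]

theorem compl_one_mul_compl (x : α) : (1 * xᶜ)ᶜ = (1 * x)ᶜᶜ := by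
  have h₁ (y : α) : (1 * yᶜ)ᶜᶜ = (1 * y)ᶜ := by
    rw [← liff_zero y, ← one_mul_liff, liff_zero]
  have h₂ : (1 * xᶜᶜ)ᶜᶜ = (1 * x)ᶜᶜ := by
    rw [← mul_one_liff_one x, ← one_mul_liff, ← mul_assoc, mul_one_liff_one]
  rw [← h₂, h₁]

theorem compl_compl (x : α) : xᶜᶜ = x := by
  have h : x = (1 * (0ᶜ ⟷ x))ᶜᶜ := by
    rw [← one_mul_liff, one_mul_compl_zero, one_liff]
  have h' (y : α) : (1 * y)ᶜᶜᶜ = (1 * y)ᶜ := by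
    rw [← compl_one_mul_compl, ← liff_zero y, ← one_mul_liff, liff_zero]
  rw [h, h']

end Involution

theorem compl_injective {x y : α} (h : xᶜ = yᶜ) : x = y := by
  rw [← compl_compl x, h, compl_compl]

theorem compl_zero : (0 : α)ᶜ = 1 := by rw [← compl_one, compl_compl]

theorem mul_one (x : α) : x * 1 = x := compl_injective (compl_mul_one x)

theorem mul_self (x : α) : x * x = x := compl_injective (compl_mul_self x)

theorem zero_mul (x : α) : 0 * x = 0 := compl_injective (compl_zero_mul x)

theorem one_mul (x : α) : 1 * x = x := by
  have h := one_mul_liff 1 x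
  rw [mul_one, one_liff, compl_compl] at h
  exact h.symm

theorem liff_one (x : α) : x ⟷ 1 = x := by
  simpa only [mul_one, compl_compl] using mul_one_liff_one x

theorem liff_eq (x y : α) : x ⟷ y = ((x * y)ᶜ * (xᶜ * yᶜ)ᶜ)ᶜ := by
  simpa only [mul_one] using mul_one_liff x y

theorem zero_liff (x : α) : 0 ⟷ x = xᶜ := by
  rw [liff_eq, zero_mul, compl_zero, one_mul, one_mul, compl_compl]

theorem mul_mul_self_left (x y : α) : x * (x * y) = x * y := by
  rw [← mul_assoc, mul_self]

theorem compl_mul_compl_mul_self (x y : α) : xᶜ * (x * y)ᶜ = xᶜ := by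
  simpa only [compl_compl] using mul_compl_compl_mul_self xᶜ y

theorem compl_mul_mul_self (x y : α) : (x * y)ᶜ * x = x * yᶜ := by
  simpa only [compl_compl] using (congrArg compl (compl_mul_eq x yᶜ)).symm

theorem mul_compl_mul (x y : α) : x * (x * y)ᶜ = x * yᶜ := by
  rw [← compl_mul_mul_self, mul_mul_self_left, compl_mul_mul_self]

theorem compl_mul_self_eq_mul_zero (x : α) : xᶜ * x = x * 0 := by
  simpa only [mul_one, compl_one] using compl_mul_mul_self x 1

theorem compl_mul_zero (x : α) : xᶜ * 0 = x * 0 := by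
  rw [← compl_mul_self_eq_mul_zero, ← compl_mul_self_eq_mul_zero, compl_compl]
  simpa only [mul_self, compl_compl] using compl_mul_mul_self xᶜ xᶜ

theorem compl_mul_zero_mul_liff (x y : α) : (x * 0)ᶜ * (x ⟷ y) = x ⟷ y := by
  have h₁ : (x * 0)ᶜ * x = x := by rw [compl_mul_mul_self, compl_zero, mul_one]
  have h₂ (u : α) : (x * 0)ᶜ * u = ((( x * 0)ᶜ * u)ᶜ * (x * 0)ᶜ)ᶜ := by
    have h := mul_liff ((x * 0)ᶜ) u 1
    rwa [liff_one, liff_one, compl_one, compl_compl, mul_assoc, zero_mul] at h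
  have h₃ := mul_liff ((x * 0)ᶜ) x y
  rw [h₁, compl_compl, mul_assoc, zero_mul] at h₃
  rw [h₂, ← h₃]

theorem mul_zero_liff_liff (x y : α) : (x * 0) ⟷ (x ⟷ y) = (x ⟷ y)ᶜ := by
  have h := mul_compl_mul (x * 0)ᶜ (x ⟷ y)ᶜ
  rw [compl_compl, compl_mul_zero_mul_liff] at h
  rw [liff_eq, mul_assoc, zero_mul, h]

theorem mul_zero_liff (x y : α) : (x * 0) ⟷ y = ((x * yᶜ)ᶜ * (xᶜ * yᶜ)ᶜ)ᶜ := by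
  rw [mul_liff, zero_liff]

theorem compl_mul_liff_self (x y : α) : (x * yᶜ) ⟷ x = (x * (y * x))ᶜ := by
  have h : (x * y)ᶜ * (x ⟷ x) = (x * y)ᶜ := by
    have h := mul_liff x y 1
    rw [liff_one, liff_one, compl_one, compl_mul_zero] at h
    rw [liff_eq, mul_self, mul_self, compl_compl, compl_mul_self_eq_mul_zero]
    simpa only [compl_compl] using (congrArg compl h).symm
  rw [← compl_mul_mul_self, mul_liff, h, compl_compl, mul_compl_mul, compl_compl, mul_assoc]

theorem mul_liff_self (x y : α) : (x * y) ⟷ x = (x * yᶜ)ᶜ := by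
  have h := compl_mul_liff_self x (x * y)ᶜ
  rwa [compl_compl, mul_mul_self_left, compl_mul_mul_self, mul_mul_self_left] at h

theorem mul_mul_liff (x y : α) : x * (y * (x ⟷ y)) = x * y := by
  rw [liff_eq, ← mul_assoc, mul_compl_compl_mul_self]

theorem mul_mul_mul_self_left (x y : α) : x * (y * x) = x * y := by
  have h := mul_mul_liff (x * y) x
  rw [mul_liff_self, mul_assoc, mul_assoc, mul_compl_mul, compl_compl, ← mul_assoc x y (x * y),
    mul_self] at h
  exact h.symm

theorem mul_mul_compl_compl_mul (x y z : α) : x * (y * (xᶜ * z)ᶜ) = x * y := by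
  have h : x * (y * (xᶜ * z)ᶜ) = x * (y * x) * (xᶜ * z)ᶜ := by
    rw [mul_mul_mul_self_left, mul_assoc]
  rw [h, mul_assoc, mul_assoc, mul_compl_compl_mul_self, mul_mul_mul_self_left]

theorem compl_mul_compl_liff (x y : α) : xᶜ * (x ⟷ y)ᶜ = xᶜ * y := by
  rw [liff_eq, compl_compl, ← mul_assoc, compl_mul_compl_mul_self, mul_compl_mul, compl_compl]

theorem mul_compl_liff (x y : α) : x * (x ⟷ y)ᶜ = x * yᶜ := by
  rw [liff_eq, compl_compl, ← mul_assoc, mul_compl_mul, mul_assoc, mul_mul_compl_compl_mul]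

theorem compl_liff (x y : α) : (x ⟷ y)ᶜ = x ⟷ yᶜ := by
  rw [← mul_zero_liff_liff, mul_zero_liff, mul_compl_liff, compl_mul_compl_liff, liff_eq,
    compl_compl]

theorem compl_left_liff (x y : α) : xᶜ ⟷ y = x ⟷ yᶜ := by
  have h₁ := mul_compl_liff xᶜ y
  have h₂ := compl_mul_compl_liff xᶜ y
  have h₃ := mul_zero_liff_liff xᶜ y
  rw [compl_compl] at h₂
  rw [compl_mul_zero, mul_zero_liff, h₁, h₂, ← liff_eq] at h₃
  rw [← compl_liff, h₃, compl_compl]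

end LIXAlgebra

/-- Derivable equality as a setoid on terms. -/
def derivSetoid : Setoid XTerm where
  r := DerivLIX
  iseqv := ⟨.refl, .symm, .trans⟩

/-- The free algebra: terms modulo derivable equality. -/
abbrev TermQuotient : Type := Quotient derivSetoid

namespace TermQuotient

/-- The class of a term. -/
abbrev mk (t : XTerm) : TermQuotient := Quotient.mk derivSetoid t

theorem mk_eq_mk {s t : XTerm} : mk s = mk t ↔ DerivLIX s t := Quotient.eq

instance : LIXAlgebra TermQuotient where
  mul := Quotient.map₂ XTerm.and fun _ _ h _ _ h' => DerivLIX.congr_and h h'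
  compl := Quotient.map XTerm.neg fun _ _ h => DerivLIX.congr_neg h
  one := mk XTerm.T
  zero := mk XTerm.F
  liff := Quotient.map₂ XTerm.iff fun _ _ h _ _ h' => DerivLIX.congr_iff h h'
  mul_assoc := by
    rintro ⟨x⟩ ⟨y⟩ ⟨z⟩
    exact mk_eq_mk.2 (.ax_assoc x y z)
  mul_or_self := by
    rintro ⟨x⟩ ⟨y⟩
    exact mk_eq_mk.2 (.trans (.congr_and (.refl x) (.symm (.ax_or x y))) (.ax_abs x y))
  one_liff := by
    rintro ⟨x⟩
    exact mk_eq_mk.2 (.ax_tx x)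
  liff_zero := by
    rintro ⟨x⟩
    exact mk_eq_mk.2 (.ax_xf x)
  mul_liff := by
    rintro ⟨x⟩ ⟨y⟩ ⟨z⟩
    exact mk_eq_mk.2 (.trans (.ax_andiff x y z) (.ax_or _ _))

theorem mk_T : mk XTerm.T = 1 := rfl

theorem mk_F : mk XTerm.F = 0 := rfl

theorem mk_neg (s : XTerm) : mk (XTerm.neg s) = (mk s)ᶜ := rfl

theorem mk_and (s t : XTerm) : mk (XTerm.and s t) = mk s * mk t := rfl

theorem mk_or (s t : XTerm) : mk (XTerm.or s t) = ((mk s)ᶜ * (mk t)ᶜ)ᶜ :=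
  mk_eq_mk.2 (.ax_or s t)

theorem mk_iff (s t : XTerm) : mk (XTerm.iff s t) = LIXAlgebra.liff (mk s) (mk t) := rfl

theorem mk_xor (s t : XTerm) : mk (XTerm.xor s t) = LIXAlgebra.liff (mk s) (mk t)ᶜ :=
  mk_eq_mk.2 (.ax_xordef s t)

end TermQuotient

theorem dl_dl (t : XTerm) : dl (dl t) = t := by
  induction t <;> simp_all only [dl]

open TermQuotient LIXAlgebra in
theorem DerivLIX.dual {s t : XTerm} (h : DerivLIX s t) : DerivLIX (dl s) (dl t) := by
  induction h with
  | refl p => exact .refl _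
  | symm _ ih => exact .symm ih
  | trans _ _ ih₁ ih₂ => exact .trans ih₁ ih₂
  | congr_neg _ ih => exact .congr_neg ih
  | congr_and _ _ ih₁ ih₂ => exact .congr_or ih₁ ih₂
  | congr_or _ _ ih₁ ih₂ => exact .congr_and ih₁ ih₂
  | congr_iff _ _ ih₁ ih₂ => exact .congr_xor ih₁ ih₂
  | congr_xor _ _ ih₁ ih₂ => exact .congr_iff ih₁ ih₂
  | ax_or x y =>
    rw [← mk_eq_mk]
    simp only [dl, mk_and, mk_neg, mk_or, LIXAlgebra.compl_compl]
  | ax_abs x y =>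
    rw [← mk_eq_mk]
    simp only [dl, mk_and, mk_or, compl_mul_compl_mul_self, LIXAlgebra.compl_compl]
  | ax_assoc x y z =>
    rw [← mk_eq_mk]
    simp only [dl, mk_or, LIXAlgebra.compl_compl, _root_.mul_assoc]
  | ax_tx x =>
    rw [← mk_eq_mk]
    simp only [dl, mk_F, mk_xor, zero_liff, LIXAlgebra.compl_compl]
  | ax_xf x =>
    rw [← mk_eq_mk]
    simp only [dl, mk_T, mk_neg, mk_xor, LIXAlgebra.compl_one, liff_zero]
  | ax_andiff x y z =>
    rw [← mk_eq_mk]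
    simp only [dl, mk_and, mk_neg, mk_or, mk_xor]
    rw [compl_left_liff, ← compl_liff, mul_liff, compl_left_liff, ← compl_liff]
    simp only [LIXAlgebra.compl_compl]
  | ax_xordef x y =>
    rw [← mk_eq_mk]
    simp only [dl, mk_iff, mk_neg, mk_xor, LIXAlgebra.compl_compl]

/-- Duality principle for EqMSCLℓIℓX: ⊢ s = t iff ⊢ s^dl = t^dl. -/
theorem eqmscl_lix_duality (s t : XTerm) :
    DerivLIX s t ↔ DerivLIX (dl s) (dl t) := by
  refine ⟨DerivLIX.dual, fun h => ?_⟩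
  simpa only [dl_dl] using h.dual
end

section
/- EqMSCLℓN^U together with the defining equations (1ℓ) ¬x = x ⊼ T, (2ℓ) x ∧❛ y = (x ⊼ y) ⊼ T, (3ℓ) x ∨❛ y = (x ⊼ T) ⊼ (y ⊼ T) derives every axiom of EqMSCL^U; conversely, EqMSCL^U together with the defining equation x ⊼ y = ¬(x ∧❛ y) derives every axiom of EqMSCLℓN^U. -/
/-- Terms built from variables, T, F, U, ¬, ∧❛, ∨❛, and the left-sequential NAND ⊼. -/
inductive UTerm : Type
  | var : Nat → UTerm
  | T : UTerm
  | F : UTerm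
  | U : UTerm
  | neg : UTerm → UTerm
  | and : UTerm → UTerm → UTerm
  | or : UTerm → UTerm → UTerm
  | nand : UTerm → UTerm → UTerm

/-- Derivability from EqMSCLℓN^U together with the defining equations
(1ℓ) ¬x = x ⊼ T, (2ℓ) x ∧❛ y = (x ⊼ y) ⊼ T, (3ℓ) x ∨❛ y = (x ⊼ T) ⊼ (y ⊼ T)
(axioms taken as schemes, so closure under substitution is built in). -/
inductive DerivN : UTerm → UTerm → Prop
  | refl (p : UTerm) : DerivN p p
  | symm {p q : UTerm} : DerivN p q → DerivN q p
  | trans {p q r : UTerm} : DerivN p q → DerivN q r → DerivN p r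
  | congr_neg {p p' : UTerm} : DerivN p p' → DerivN (UTerm.neg p) (UTerm.neg p')
  | congr_and {p p' q q' : UTerm} : DerivN p p' → DerivN q q' →
      DerivN (UTerm.and p q) (UTerm.and p' q')
  | congr_or {p p' q q' : UTerm} : DerivN p p' → DerivN q q' →
      DerivN (UTerm.or p q) (UTerm.or p' q')
  | congr_nand {p p' q q' : UTerm} : DerivN p p' → DerivN q q' →
      DerivN (UTerm.nand p q) (UTerm.nand p' q')
  | ax_n1 : DerivN UTerm.F (UTerm.nand UTerm.T UTerm.T)
  | ax_n2 (x y : UTerm) :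
      DerivN (UTerm.nand (UTerm.nand UTerm.T x) (UTerm.nand x y)) x
  | ax_n3 (x y z : UTerm) :
      DerivN (UTerm.nand (UTerm.nand x (UTerm.nand y UTerm.T)) z)
             (UTerm.nand
               (UTerm.nand (UTerm.nand x (UTerm.nand (UTerm.nand y z) UTerm.T))
                           (UTerm.nand (UTerm.nand x UTerm.T) z))
               UTerm.T)
  | ax_nu (x : UTerm) : DerivN (UTerm.nand UTerm.U x) UTerm.U
  | ax_negdef (x : UTerm) : DerivN (UTerm.neg x) (UTerm.nand x UTerm.T)
  | ax_anddef (x y : UTerm) :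
      DerivN (UTerm.and x y) (UTerm.nand (UTerm.nand x y) UTerm.T)
  | ax_ordef (x y : UTerm) :
      DerivN (UTerm.or x y)
             (UTerm.nand (UTerm.nand x UTerm.T) (UTerm.nand y UTerm.T))

/-- Derivability from EqMSCL^U together with the defining equation x ⊼ y = ¬(x ∧❛ y)
(axioms taken as schemes, so closure under substitution is built in). -/
inductive DerivE : UTerm → UTerm → Prop
  | refl (p : UTerm) : DerivE p p
  | symm {p q : UTerm} : DerivE p q → DerivE q p
  | trans {p q r : UTerm} : DerivE p q → DerivE q r → DerivE p r
  | congr_neg {p p' : UTerm} : DerivE p p' → DerivE (UTerm.neg p) (UTerm.neg p')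
  | congr_and {p p' q q' : UTerm} : DerivE p p' → DerivE q q' →
      DerivE (UTerm.and p q) (UTerm.and p' q')
  | congr_or {p p' q q' : UTerm} : DerivE p p' → DerivE q q' →
      DerivE (UTerm.or p q) (UTerm.or p' q')
  | congr_nand {p p' q q' : UTerm} : DerivE p p' → DerivE q q' →
      DerivE (UTerm.nand p q) (UTerm.nand p' q')
  | ax_neg : DerivE UTerm.F (UTerm.neg UTerm.T)
  | ax_or (x y : UTerm) :
      DerivE (UTerm.or x y) (UTerm.neg (UTerm.and (UTerm.neg x) (UTerm.neg y)))
  | ax_tand (x : UTerm) : DerivE (UTerm.and UTerm.T x) x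
  | ax_abs (x y : UTerm) : DerivE (UTerm.and x (UTerm.or x y)) x
  | ax_mem (x y z : UTerm) :
      DerivE (UTerm.and (UTerm.or x y) z)
             (UTerm.or (UTerm.and (UTerm.neg x) (UTerm.and y z)) (UTerm.and x z))
  | ax_und : DerivE (UTerm.neg UTerm.U) UTerm.U
  | ax_nanddef (x y : UTerm) :
      DerivE (UTerm.nand x y) (UTerm.neg (UTerm.and x y))

/-- Algebras satisfying the equations (N2) and (N3) of `EqMSCLℓN^U`. -/
structure NandLaws {A : Type*} (f : A → A → A) (T : A) : Prop where
  absorb : ∀ x y, f (f T x) (f x y) = x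
  mem : ∀ x y z, f (f x (f y T)) z = f (f (f x (f (f y z) T)) (f (f x T) z)) T

namespace NandLaws

variable {A : Type*} {f : A → A → A} {T : A} (h : NandLaws f T)
include h

theorem false_nand_true : f (f T T) T = T := by
  obtain ⟨h2, h3⟩ := h
  grind (gen := 8) (ematch := 8) (instances := 5000)

theorem true_nand_false : f T (f T T) = T := by
  have hnF := h.false_nand_true
  obtain ⟨h2, h3⟩ := h
  generalize hF : f T T = F at *
  grind (gen := 8) (ematch := 8) (instances := 3000)

theorem false_nand (z : A) : f (f T T) z = T := by
  have hnF := h.false_nand_true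
  have hTF := h.true_nand_false
  obtain ⟨h2, h3⟩ := h
  generalize hF : f T T = F at *
  grind (gen := 8) (ematch := 8) (instances := 3000)

theorem double_neg (z : A) : f (f z T) T = z := by
  have hnF := h.false_nand_true
  have hTF := h.true_nand_false
  have hFz := h.false_nand
  obtain ⟨h2, h3⟩ := h
  generalize hF : f T T = F at *
  grind (gen := 8) (ematch := 8) (instances := 3000)

theorem true_nand (z : A) : f T z = f z T := by
  have nn := h.double_neg
  obtain ⟨h2, h3⟩ := h
  grind (gen := 8) (ematch := 8) (instances := 3000)

theorem nand_or (x y : A) : f x (f (f x T) (f y T)) = f x T := by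
  have nn := h.double_neg
  have nT := h.true_nand
  have h2 := h.absorb
  grind

end NandLaws

/-- Algebras satisfying the equations (Tand), (Abs) and (Mem) of `EqMSCL^U`, with disjunction
eliminated by (Or). -/
structure AndLaws {A : Type*} (a : A → A → A) (n : A → A) (T : A) : Prop where
  true_and : ∀ x, a T x = x
  absorb : ∀ x y, a x (n (a (n x) (n y))) = x
  mem : ∀ x y z, a (n (a (n x) (n y))) z = n (a (n (a (n x) (a y z))) (n (a x z)))

namespace AndLaws

variable {A : Type*} {a : A → A → A} {n : A → A} {T : A} (h : AndLaws a n T)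
include h

theorem neg_false_and_neg (y : A) : n (a (n T) (n y)) = T := by
  rw [← h.true_and (n (a (n T) (n y))), h.absorb]

theorem neg_neg (x : A) : n (n x) = x := by
  have key : ∀ z, n (a (n (a (n T) z)) (n z)) = z := fun z => by
    have := h.mem T T z
    rw [h.neg_false_and_neg, h.true_and] at this
    exact this.symm
  have triple : ∀ w, n (n (n w)) = n w := fun w => by
    have := key (n w)
    rwa [h.neg_false_and_neg, h.true_and] at this
  rw [← key x, triple]

theorem false_and (y : A) : a (n T) y = n T := by
  have := congrArg n (h.neg_false_and_neg (n y))
  rwa [h.neg_neg, h.neg_neg] at this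

theorem and_true (x : A) : a x T = x := by
  have := h.mem (n T) T (n x)
  rw [h.neg_neg, h.true_and, h.neg_neg, h.true_and, h.true_and, h.false_and, h.neg_neg,
    h.neg_neg] at this
  rw [← h.neg_neg (a x T), ← this, h.neg_neg]

theorem neg_and_neg_and (x y : A) : a (n x) (n (a x y)) = n x := by
  have := h.absorb (n x) (n y)
  rwa [h.neg_neg, h.neg_neg] at this

theorem and_self (x : A) : a x x = x := by
  have := h.absorb x (n T)
  rwa [h.neg_neg, h.and_true, h.neg_neg] at this

theorem and_eq_of_neg_eq {u : A} (hu : n u = u) (x : A) : a u x = u := by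
  have huF : a u (n T) = u := by
    have := h.mem u T T
    rw [hu, h.true_and, h.and_true, h.and_true, hu, h.and_self, hu] at this
    rw [← h.neg_neg (a u (n T)), this, hu]
  have h1 := h.mem u (n T) x
  have h2 := h.neg_and_neg_and u x
  rw [hu] at h2
  rw [hu, h.neg_neg, h.and_true, hu, h.false_and, huF, hu, h2, hu] at h1
  exact h1

end AndLaws

/-- The setoid of derivability from `EqMSCLℓN^U`. -/
def DerivN.setoid : Setoid UTerm := ⟨DerivN, .refl, .symm, .trans⟩

/-- The setoid of derivability from `EqMSCL^U`. -/
def DerivE.setoid : Setoid UTerm := ⟨DerivE, .refl, .symm, .trans⟩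

/-- The operation of `⊼` on terms modulo derivability from `EqMSCLℓN^U`. -/
def DerivN.nand : Quotient DerivN.setoid → Quotient DerivN.setoid → Quotient DerivN.setoid :=
  Quotient.map₂ UTerm.nand fun _ _ hp _ _ hq => DerivN.congr_nand hp hq

/-- The operation of `∧❛` on terms modulo derivability from `EqMSCL^U`. -/
def DerivE.and : Quotient DerivE.setoid → Quotient DerivE.setoid → Quotient DerivE.setoid :=
  Quotient.map₂ UTerm.and fun _ _ hp _ _ hq => DerivE.congr_and hp hq

/-- The operation of `¬` on terms modulo derivability from `EqMSCL^U`. -/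
def DerivE.neg : Quotient DerivE.setoid → Quotient DerivE.setoid :=
  Quotient.map UTerm.neg fun _ _ hp => DerivE.congr_neg hp

namespace DerivN

/-- The class of a term modulo derivability from `EqMSCLℓN^U`. -/
def mk (x : UTerm) : Quotient DerivN.setoid := Quotient.mk _ x

theorem iff_mk_eq {x y : UTerm} : DerivN x y ↔ mk x = mk y :=
  ⟨fun h => Quotient.sound h, fun h => Quotient.exact h⟩

theorem mk_neg (x : UTerm) : mk (.neg x) = nand (mk x) (mk .T) :=
  iff_mk_eq.1 (ax_negdef x)

theorem mk_and (x y : UTerm) : mk (.and x y) = nand (nand (mk x) (mk y)) (mk .T) :=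
  iff_mk_eq.1 (ax_anddef x y)

theorem mk_or (x y : UTerm) :
    mk (.or x y) = nand (nand (mk x) (mk .T)) (nand (mk y) (mk .T)) :=
  iff_mk_eq.1 (ax_ordef x y)

theorem nandLaws : NandLaws nand (mk .T) where
  absorb x y := Quotient.inductionOn₂ x y fun x y => iff_mk_eq.1 (ax_n2 x y)
  mem x y z := Quotient.inductionOn₃ x y z fun x y z => iff_mk_eq.1 (ax_n3 x y z)

end DerivN

namespace DerivE

/-- The class of a term modulo derivability from `EqMSCL^U`. -/
def mk (x : UTerm) : Quotient DerivE.setoid := Quotient.mk _ x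

theorem iff_mk_eq {x y : UTerm} : DerivE x y ↔ mk x = mk y :=
  ⟨fun h => Quotient.sound h, fun h => Quotient.exact h⟩

theorem mk_neg (x : UTerm) : mk (.neg x) = neg (mk x) := rfl

theorem mk_nand (x y : UTerm) : mk (.nand x y) = neg (and (mk x) (mk y)) :=
  iff_mk_eq.1 (ax_nanddef x y)

theorem andLaws : AndLaws and neg (mk .T) where
  true_and x := Quotient.inductionOn x fun x => iff_mk_eq.1 (ax_tand x)
  absorb x y := Quotient.inductionOn₂ x y fun x y =>
    iff_mk_eq.1 (.trans (.congr_and (.refl _) (.symm (ax_or x y))) (ax_abs x y))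
  mem x y z := Quotient.inductionOn₃ x y z fun x y z =>
    iff_mk_eq.1 (.trans (.congr_and (.symm (ax_or x y)) (.refl _))
      (.trans (ax_mem x y z) (ax_or _ _)))

end DerivE

/-- EqMSCLℓN^U + (1ℓ),(2ℓ),(3ℓ) derives every axiom of EqMSCL^U; conversely,
EqMSCL^U + (x ⊼ y = ¬(x ∧❛ y)) derives every axiom of EqMSCLℓN^U. -/
theorem eqmscl_lnu_correspondence :
    ((DerivN UTerm.F (UTerm.neg UTerm.T)) ∧
     (∀ x y : UTerm, DerivN (UTerm.or x y)
         (UTerm.neg (UTerm.and (UTerm.neg x) (UTerm.neg y)))) ∧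
     (∀ x : UTerm, DerivN (UTerm.and UTerm.T x) x) ∧
     (∀ x y : UTerm, DerivN (UTerm.and x (UTerm.or x y)) x) ∧
     (∀ x y z : UTerm, DerivN (UTerm.and (UTerm.or x y) z)
         (UTerm.or (UTerm.and (UTerm.neg x) (UTerm.and y z)) (UTerm.and x z))) ∧
     (DerivN (UTerm.neg UTerm.U) UTerm.U)) ∧
    ((DerivE UTerm.F (UTerm.nand UTerm.T UTerm.T)) ∧
     (∀ x y : UTerm, DerivE (UTerm.nand (UTerm.nand UTerm.T x) (UTerm.nand x y)) x) ∧
     (∀ x y z : UTerm, DerivE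
         (UTerm.nand (UTerm.nand x (UTerm.nand y UTerm.T)) z)
         (UTerm.nand
           (UTerm.nand (UTerm.nand x (UTerm.nand (UTerm.nand y z) UTerm.T))
                       (UTerm.nand (UTerm.nand x UTerm.T) z))
           UTerm.T)) ∧
     (∀ x : UTerm, DerivE (UTerm.nand UTerm.U x) UTerm.U)) := by
  refine ⟨⟨?_, fun x y => ?_, fun x => ?_, fun x y => ?_, fun x y z => ?_, ?_⟩,
    ⟨?_, fun x y => ?_, fun x y z => ?_, fun x => ?_⟩⟩
  · exact .trans .ax_n1 (.symm (.ax_negdef _))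
  · simp only [DerivN.iff_mk_eq, DerivN.mk_neg, DerivN.mk_and, DerivN.mk_or,
      DerivN.nandLaws.double_neg]
  · simp only [DerivN.iff_mk_eq, DerivN.mk_and, DerivN.nandLaws.true_nand,
      DerivN.nandLaws.double_neg]
  · simp only [DerivN.iff_mk_eq, DerivN.mk_and, DerivN.mk_or, DerivN.nandLaws.nand_or,
      DerivN.nandLaws.double_neg]
  · simp only [DerivN.iff_mk_eq, DerivN.mk_neg, DerivN.mk_and, DerivN.mk_or]
    rw [DerivN.nandLaws.mem]
    simp only [DerivN.nandLaws.double_neg]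
  · exact .trans (.ax_negdef _) (.ax_nu _)
  · rw [DerivE.iff_mk_eq, DerivE.mk_nand, DerivE.andLaws.true_and, ← DerivE.mk_neg]
    exact DerivE.iff_mk_eq.1 .ax_neg
  · simp only [DerivE.iff_mk_eq, DerivE.mk_nand, DerivE.andLaws.true_and,
      DerivE.andLaws.neg_and_neg_and, DerivE.andLaws.neg_neg]
  · have := DerivE.andLaws.mem (DerivE.neg (DerivE.mk x)) (DerivE.mk y) (DerivE.mk z)
    simp only [DerivE.andLaws.neg_neg] at this
    simp only [DerivE.iff_mk_eq, DerivE.mk_nand, DerivE.andLaws.and_true,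
      DerivE.andLaws.neg_neg, this]
  · have hU : DerivE.neg (DerivE.mk .U) = DerivE.mk .U := DerivE.iff_mk_eq.1 .ax_und
    rw [DerivE.iff_mk_eq, DerivE.mk_nand, DerivE.andLaws.and_eq_of_neg_eq hU, hU]
end

section
/- For every closed term P built from T, F, U, atoms, and the left-sequential NAND ⊼, there exists a memorising U-nand basic form Q such that EqMSCLℓN^U ⊢ P = Q. -/
/-- Closed terms built from T, F, U, atoms, and the left-sequential NAND ⊼. -/
inductive NC (A : Type) : Type
  | T : NC A
  | F : NC A
  | U : NC A
  | at_ : A → NC A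
  | nand : NC A → NC A → NC A

/-- EqMSCLℓN^U-derivability on closed terms: the smallest congruence for ⊼
containing all closed instances of (N1), (N2), (N3) and (NU). -/
inductive NDeriv {A : Type} : NC A → NC A → Prop
  | refl (p : NC A) : NDeriv p p
  | symm {p q : NC A} : NDeriv p q → NDeriv q p
  | trans {p q r : NC A} : NDeriv p q → NDeriv q r → NDeriv p r
  | congr_nand {p p' q q' : NC A} : NDeriv p p' → NDeriv q q' →
      NDeriv (NC.nand p q) (NC.nand p' q')
  | ax_n1 : NDeriv NC.F (NC.nand NC.T NC.T)
  | ax_n2 (x y : NC A) :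
      NDeriv (NC.nand (NC.nand NC.T x) (NC.nand x y)) x
  | ax_n3 (x y z : NC A) :
      NDeriv (NC.nand (NC.nand x (NC.nand y NC.T)) z)
             (NC.nand
               (NC.nand (NC.nand x (NC.nand (NC.nand y z) NC.T))
                        (NC.nand (NC.nand x NC.T) z))
               NC.T)
  | ax_nu (x : NC A) : NDeriv (NC.nand NC.U x) NC.U

/-- Occurrence of an atom in a closed term. -/
def occurs {A : Type} (a : A) : NC A → Prop
  | NC.T => False
  | NC.F => False
  | NC.U => False
  | NC.at_ b => b = a
  | NC.nand p q => occurs a p ∨ occurs a q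

/-- Memorising U-nand basic forms (mUNBFs):
T, F, U are mUNBFs, and (at(a) ⊼ P) ⊼ ((at(a) ⊼ T) ⊼ Q) is a mUNBF whenever
P and Q are mUNBFs not containing the atom a. -/
inductive IsMUNBF {A : Type} : NC A → Prop
  | T : IsMUNBF NC.T
  | F : IsMUNBF NC.F
  | U : IsMUNBF NC.U
  | node (a : A) {p q : NC A} : IsMUNBF p → IsMUNBF q →
      ¬ occurs a p → ¬ occurs a q →
      IsMUNBF (NC.nand (NC.nand (NC.at_ a) p)
                       (NC.nand (NC.nand (NC.at_ a) NC.T) q))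

/-- The function T_a^U (defined on mUNBFs; extended trivially elsewhere). -/
def Ta {A : Type} [DecidableEq A] (a : A) : NC A → NC A
  | NC.nand (NC.nand (NC.at_ b) p1) (NC.nand (NC.nand (NC.at_ c) NC.T) p2) =>
      if b = c then
        (if b = a then p1
         else NC.nand (NC.nand (NC.at_ b) (Ta a p1))
                      (NC.nand (NC.nand (NC.at_ c) NC.T) (Ta a p2)))
      else NC.nand (NC.nand (NC.at_ b) p1) (NC.nand (NC.nand (NC.at_ c) NC.T) p2)
  | t => t

/-- The function F_a^U (defined on mUNBFs; extended trivially elsewhere). -/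
def Fa {A : Type} [DecidableEq A] (a : A) : NC A → NC A
  | NC.nand (NC.nand (NC.at_ b) p1) (NC.nand (NC.nand (NC.at_ c) NC.T) p2) =>
      if b = c then
        (if b = a then p2
         else NC.nand (NC.nand (NC.at_ b) (Fa a p1))
                      (NC.nand (NC.nand (NC.at_ c) NC.T) (Fa a p2)))
      else NC.nand (NC.nand (NC.at_ b) p1) (NC.nand (NC.nand (NC.at_ c) NC.T) p2)
  | t => t

/-- Algebras for the `U`-free axioms of left-sequential NAND. -/
class SeqNand (M : Type) where
  nand : M → M → M
  tt : M
  absorb (x y : M) : nand (nand tt x) (nand x y) = x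
  distrib (x y z : M) : nand (nand x (nand y tt)) z =
    nand (nand (nand x (nand (nand y z) tt)) (nand (nand x tt) z)) tt

namespace SeqNand

local notation:70 x:70 "⊼ₗ" y:71 => SeqNand.nand x y

variable {M : Type} [SeqNand M]

/-- The constant false. -/
def ff : M := tt ⊼ₗ tt

theorem tt_nand_tt : (tt ⊼ₗ tt : M) = ff := rfl

/-! ### Double negation and the constants -/

theorem ff_nand_tt_nand (x : M) : ff ⊼ₗ (tt ⊼ₗ x) = tt := absorb tt x

theorem ff_nand_ff : (ff ⊼ₗ ff : M) = tt := ff_nand_tt_nand tt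

theorem tt_nand_ff_nand_tt : (tt ⊼ₗ ff ⊼ₗ tt : M) = ff := by
  have h := absorb (ff : M) (tt ⊼ₗ tt)
  rwa [ff_nand_tt_nand] at h

theorem nand_ff_nand_ff (x : M) :
    x ⊼ₗ ff ⊼ₗ ff = (x ⊼ₗ ff) ⊼ₗ (x ⊼ₗ tt ⊼ₗ ff) ⊼ₗ tt := by
  have h := distrib x tt (ff : M)
  rwa [tt_nand_ff_nand_tt, tt_nand_tt] at h

theorem tt_nand_ff_nand_ff : (tt ⊼ₗ ff ⊼ₗ ff : M) = ff ⊼ₗ tt := by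
  rw [nand_ff_nand_ff, tt_nand_tt, ff_nand_ff, tt_nand_ff_nand_tt]

theorem nand_ff_nand_tt_nand_ff (x : M) : x ⊼ₗ (ff ⊼ₗ tt) ⊼ₗ ff = x ⊼ₗ ff ⊼ₗ ff := by
  rw [distrib x ff ff, ff_nand_ff, tt_nand_tt, nand_ff_nand_ff x]

theorem ff_nand_tt_nand_ff : (ff ⊼ₗ tt ⊼ₗ ff : M) = tt := by
  have h := nand_ff_nand_tt_nand_ff (tt ⊼ₗ ff : M)
  rw [absorb, ff_nand_ff, tt_nand_ff_nand_ff] at h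
  exact h.symm

theorem ff_nand_tt_eq_tt_nand_ff : (ff ⊼ₗ tt : M) = tt ⊼ₗ ff := by
  have h := nand_ff_nand_ff (ff : M)
  rw [ff_nand_ff, ff_nand_tt_nand_ff, tt_nand_tt] at h
  exact h.symm

theorem tt_nand_ff : (tt ⊼ₗ ff : M) = tt := by
  have h := tt_nand_ff_nand_ff (M := M)
  rwa [← ff_nand_tt_eq_tt_nand_ff, ff_nand_tt_nand_ff, ff_nand_tt_eq_tt_nand_ff, eq_comm] at h

theorem ff_nand_tt : (ff ⊼ₗ tt : M) = tt := by
  rw [ff_nand_tt_eq_tt_nand_ff, tt_nand_ff]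

theorem tt_nand_ff_nand (x : M) : tt ⊼ₗ (ff ⊼ₗ x) = ff := by
  have h := absorb ff x
  rwa [tt_nand_ff] at h

theorem ff_nand_ff_nand_nand (x y : M) : ff ⊼ₗ (ff ⊼ₗ x ⊼ₗ y) = ff ⊼ₗ x := by
  have h := absorb (ff ⊼ₗ x) y
  rwa [tt_nand_ff_nand] at h

theorem ff_nand_nand_tt_nand (x : M) : ff ⊼ₗ x ⊼ₗ (tt ⊼ₗ x) ⊼ₗ tt = tt ⊼ₗ x := by
  have h := distrib ff ff x
  rw [ff_nand_ff_nand_nand, ff_nand_tt, ff_nand_tt] at h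
  exact h.symm

theorem tt_nand_distrib (x y : M) :
    tt ⊼ₗ (x ⊼ₗ tt) ⊼ₗ y = tt ⊼ₗ (x ⊼ₗ y ⊼ₗ tt) ⊼ₗ (ff ⊼ₗ y) ⊼ₗ tt :=
  distrib tt x y

theorem ff_nand_distrib (x y : M) :
    ff ⊼ₗ (x ⊼ₗ tt) ⊼ₗ y = ff ⊼ₗ (x ⊼ₗ y ⊼ₗ tt) ⊼ₗ (tt ⊼ₗ y) ⊼ₗ tt := by
  rw [distrib ff x y, ff_nand_tt]

theorem ff_nand_ff_nand_nand_ff (x : M) : ff ⊼ₗ (ff ⊼ₗ x) ⊼ₗ ff = tt := by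
  have h := ff_nand_distrib (ff ⊼ₗ (ff ⊼ₗ x)) (ff : M)
  have k := ff_nand_nand_tt_nand (ff ⊼ₗ x)
  rw [tt_nand_ff_nand] at k
  rw [ff_nand_ff_nand_nand, k, ff_nand_ff, tt_nand_ff, tt_nand_tt, ff_nand_tt] at h
  exact h

theorem ff_nand_ff_nand (x : M) : ff ⊼ₗ (ff ⊼ₗ x) = tt := by
  rw [← ff_nand_ff_nand_nand (ff ⊼ₗ x) ff, ff_nand_ff_nand_nand_ff, ff_nand_tt]

theorem tt_nand_tt_nand_nand_tt (x : M) :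
    tt ⊼ₗ (tt ⊼ₗ x) ⊼ₗ tt = tt ⊼ₗ (tt ⊼ₗ (tt ⊼ₗ x)) := by
  have k : tt ⊼ₗ (tt ⊼ₗ (tt ⊼ₗ x)) ⊼ₗ tt = tt ⊼ₗ (tt ⊼ₗ x) := by
    have h := ff_nand_nand_tt_nand (tt ⊼ₗ x)
    rwa [ff_nand_tt_nand] at h
  have h := tt_nand_distrib tt (tt ⊼ₗ (tt ⊼ₗ x))
  rw [ff_nand_tt_nand, k, k, tt_nand_tt, tt_nand_ff] at h
  exact h.symm

theorem ff_nand_tt_nand_nand_tt (x : M) : ff ⊼ₗ (tt ⊼ₗ x ⊼ₗ tt) = tt := by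
  have h := ff_nand_distrib (tt ⊼ₗ x) (x ⊼ₗ tt)
  rw [absorb, ff_nand_nand_tt_nand] at h
  rw [← ff_nand_ff_nand_nand _ (x ⊼ₗ tt), h, ff_nand_tt_nand]

theorem tt_nand_tt_nand_tt_nand (x : M) : tt ⊼ₗ (tt ⊼ₗ (tt ⊼ₗ x)) = tt ⊼ₗ x := by
  have h := ff_nand_distrib tt x
  rw [ff_nand_tt_nand_nand_tt, tt_nand_tt, ff_nand_ff] at h
  exact (tt_nand_tt_nand_nand_tt x).symm.trans h.symm

theorem tt_nand_nand_tt (x : M) : tt ⊼ₗ x ⊼ₗ tt = tt ⊼ₗ (tt ⊼ₗ x) := by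
  have h := tt_nand_tt_nand_nand_tt (tt ⊼ₗ x)
  rwa [tt_nand_tt_nand_tt_nand] at h

theorem tt_nand_nand_tt_nand_tt (x : M) :
    tt ⊼ₗ (x ⊼ₗ tt ⊼ₗ tt) = tt ⊼ₗ (tt ⊼ₗ (x ⊼ₗ tt)) := by
  have h := tt_nand_distrib x tt
  rw [ff_nand_tt, tt_nand_nand_tt, tt_nand_nand_tt, tt_nand_nand_tt,
    tt_nand_tt_nand_tt_nand] at h
  exact h.symm

theorem tt_nand_tt_nand_nand_ff_nand (x y : M) :
    tt ⊼ₗ (tt ⊼ₗ (x ⊼ₗ (ff ⊼ₗ (x ⊼ₗ y)) ⊼ₗ tt)) = x := by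
  have h := tt_nand_distrib x (ff ⊼ₗ (x ⊼ₗ y))
  have k := tt_nand_distrib (tt ⊼ₗ x) (x ⊼ₗ y)
  rw [ff_nand_ff_nand, tt_nand_nand_tt, tt_nand_nand_tt, tt_nand_tt_nand_tt_nand] at h
  rw [absorb, tt_nand_nand_tt, tt_nand_tt_nand_tt_nand, absorb, h, tt_nand_nand_tt] at k
  exact k.symm

theorem ff_nand (x : M) : ff ⊼ₗ x = tt := by
  rw [← tt_nand_tt_nand_nand_ff_nand x x, ff_nand_tt_nand]

theorem tt_nand_nand_tt_eq_self (x : M) : tt ⊼ₗ (x ⊼ₗ tt) = x := by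
  have h := tt_nand_tt_nand_nand_ff_nand x x
  rwa [ff_nand, tt_nand_nand_tt_nand_tt, tt_nand_tt_nand_tt_nand] at h

theorem tt_nand (x : M) : tt ⊼ₗ x = x ⊼ₗ tt := by
  rw [← tt_nand_nand_tt_eq_self (x ⊼ₗ tt), tt_nand_nand_tt_nand_tt, tt_nand_nand_tt_eq_self]

theorem nand_tt_nand_tt (x : M) : x ⊼ₗ tt ⊼ₗ tt = x := by
  rw [← tt_nand, tt_nand_nand_tt_eq_self]

/-! ### Negation and conjunction -/

/-- Negation. -/
def neg (x : M) : M := x ⊼ₗ tt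

/-- Left-sequential conjunction. -/
def conj (x y : M) : M := neg (x ⊼ₗ y)

local prefix:max "∼" => SeqNand.neg
local notation:75 x:75 "⊙" y:76 => SeqNand.conj x y

theorem neg_neg (x : M) : ∼(∼x) = x := nand_tt_nand_tt x

theorem nand_eq (x y : M) : x ⊼ₗ y = ∼(x ⊙ y) := (neg_neg _).symm

theorem neg_tt : ∼(tt : M) = ff := rfl

theorem neg_ff : ∼(ff : M) = tt := ff_nand_tt

theorem tt_conj (x : M) : tt ⊙ x = x := by
  rw [conj, tt_nand]; exact neg_neg x

theorem conj_tt (x : M) : x ⊙ tt = x := neg_neg x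

theorem ff_conj (x : M) : ff ⊙ x = ff := by
  rw [conj, ff_nand, neg_tt]

theorem neg_neg_conj_neg_conj (x y : M) : ∼(∼x ⊙ ∼(x ⊙ y)) = x := by
  rw [← nand_eq, ← nand_eq, neg, ← tt_nand]
  exact absorb x y

theorem conj_neg_neg_conj (x y : M) : x ⊙ ∼(∼x ⊙ y) = x := by
  rw [← neg_neg (x ⊙ _), ← neg_neg x, neg_neg ∼x, neg_neg_conj_neg_conj ∼x y]

theorem neg_conj_neg_conj (x y z : M) :
    ∼(x ⊙ ∼y) ⊙ z = ∼(∼(x ⊙ (y ⊙ z)) ⊙ ∼(∼x ⊙ z)) := by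
  rw [conj, ← nand_eq, ← nand_eq, ← nand_eq, ← nand_eq]
  exact (congrArg neg (distrib x y z)).trans (neg_neg _)

theorem conj_self (x : M) : x ⊙ x = x := by
  have h := neg_neg_conj_neg_conj (∼x) tt
  rw [conj_tt, neg_neg] at h
  rw [← neg_neg (x ⊙ x), h, neg_neg]

theorem neg_conj_conj_self (x y : M) : ∼(x ⊙ y) ⊙ x = x ⊙ ∼y := by
  have h := neg_conj_neg_conj x y tt
  rw [conj_tt, conj_tt, conj_tt, neg_neg] at h
  rw [← neg_neg (x ⊙ ∼y), h, neg_neg]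

theorem neg_conj_self (x : M) : ∼x ⊙ x = x ⊙ ff := by
  have h := neg_conj_conj_self x tt
  rwa [conj_tt, neg_tt] at h

theorem conj_neg_self (x : M) : x ⊙ ∼x = x ⊙ ff := by
  rw [← neg_conj_conj_self, conj_self, neg_conj_self]

theorem neg_conj_ff (x : M) : ∼x ⊙ ff = x ⊙ ff := by
  rw [← neg_conj_self, neg_neg, conj_neg_self]

theorem conj_neg_conj (x y : M) : x ⊙ (∼x ⊙ y) = x ⊙ ff := by
  rw [← neg_neg (∼x ⊙ y), ← neg_conj_conj_self, conj_neg_neg_conj, neg_conj_self]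

theorem neg_neg_conj_conj_neg_neg_conj (x y : M) :
    ∼(∼(x ⊙ y) ⊙ ∼(∼x ⊙ y)) = ∼(x ⊙ ff) ⊙ y := by
  rw [← neg_tt, neg_conj_neg_conj, tt_conj]

theorem neg_neg_conj_ff_conj_neg_conj (x y : M) :
    ∼(∼(x ⊙ ff) ⊙ ∼(x ⊙ y)) = x ⊙ y := by
  have h := neg_conj_neg_conj (∼x) ff y
  rw [ff_conj, neg_ff, conj_tt, neg_neg, neg_conj_ff] at h
  exact h.symm

theorem conj_conj_self (x y : M) : x ⊙ (x ⊙ y) = x ⊙ y := by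
  have h := neg_neg_conj_conj_neg_neg_conj x ∼(x ⊙ y)
  rw [neg_neg_conj_neg_conj] at h
  rw [← neg_neg (x ⊙ y), ← neg_conj_conj_self, ← neg_neg (_ ⊙ x), h,
    neg_neg_conj_ff_conj_neg_conj, neg_neg]

theorem conj_neg_conj_self (x y : M) : x ⊙ ∼(x ⊙ y) = x ⊙ ∼y := by
  rw [← neg_conj_conj_self x (x ⊙ y), conj_conj_self, neg_conj_conj_self]

theorem conj_neg_conj_neg_conj (x y z : M) :
    x ⊙ ∼(y ⊙ ∼(x ⊙ z)) = ∼(∼(x ⊙ ∼y) ⊙ ∼(x ⊙ z)) := by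
  rw [neg_conj_neg_conj, neg_neg_conj_neg_conj, neg_neg, neg_conj_conj_self]

theorem conj_neg_neg_conj_conj (x y z : M) : x ⊙ (∼(∼x ⊙ y) ⊙ z) = x ⊙ z := by
  rw [← neg_neg y, neg_conj_neg_conj, neg_neg x, conj_neg_conj_neg_conj, neg_neg,
    conj_neg_conj, neg_neg_conj_ff_conj_neg_conj]

theorem conj_ff_conj (x y : M) : x ⊙ ff ⊙ y = x ⊙ ff := by
  have h := neg_neg_conj_ff_conj_neg_conj x tt
  rw [conj_tt] at h
  calc x ⊙ ff ⊙ y = x ⊙ ff ⊙ (∼(∼(x ⊙ ff) ⊙ ∼x) ⊙ y) := by rw [conj_neg_neg_conj_conj]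
    _ = x ⊙ ff ⊙ (x ⊙ y) := by rw [h]
    _ = x ⊙ ff ⊙ ∼(∼(x ⊙ ff) ⊙ ∼(x ⊙ y)) := by rw [neg_neg_conj_ff_conj_neg_conj]
    _ = x ⊙ ff := conj_neg_neg_conj _ _

theorem conj_eq_left_of_conj_eq_right {x y : M} (h : x ⊙ y = y) : y ⊙ x = y := by
  rw [← neg_neg x, ← neg_conj_conj_self, neg_conj_neg_conj, h, conj_self, neg_conj_self,
    neg_neg_conj_neg_conj]

theorem conj_conj_left (x y : M) : x ⊙ (y ⊙ x) = x ⊙ y := by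
  have h : ∼(x ⊙ ff) ⊙ ∼(x ⊙ (y ⊙ x)) = ∼(x ⊙ (y ⊙ x)) := by
    rw [← neg_neg (_ ⊙ _), neg_neg_conj_ff_conj_neg_conj]
  have k := neg_conj_neg_conj x y x
  rw [neg_conj_self, conj_eq_left_of_conj_eq_right h, neg_neg, neg_conj_conj_self, neg_neg] at k
  exact k.symm

theorem conj_conj_neg_neg_conj (x y z : M) : x ⊙ (y ⊙ ∼(∼x ⊙ z)) = x ⊙ y := by
  rw [← conj_neg_neg_conj_conj x z (y ⊙ _), conj_conj_left, conj_neg_neg_conj_conj]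

/-- `x ⊙ -` only depends on the positive branch of a conditional on `x`. -/
theorem conj_cond_self (x p q : M) : x ⊙ ∼(∼(x ⊙ p) ⊙ ∼(∼x ⊙ q)) = x ⊙ p := by
  rw [← conj_neg_conj_self, conj_conj_neg_neg_conj, conj_neg_conj_self, neg_neg, conj_conj_self]

theorem neg_conj_cond_self (x p q : M) : ∼x ⊙ ∼(∼(x ⊙ p) ⊙ ∼(∼x ⊙ q)) = ∼x ⊙ q := by
  have h := conj_neg_neg_conj_conj (∼x) p ∼(∼x ⊙ q)
  rw [neg_neg] at h
  rw [← conj_neg_conj_self, h, conj_neg_conj_self, neg_neg, conj_conj_self]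

theorem conj_neg_conj_neg_conj_self (x y z : M) : x ⊙ (∼(x ⊙ ∼y) ⊙ z) = x ⊙ (y ⊙ z) := by
  rw [neg_conj_neg_conj, conj_cond_self]

theorem conj_neg_conj_conj (x y z : M) : x ⊙ (∼(x ⊙ y) ⊙ z) = x ⊙ (∼y ⊙ z) := by
  have h := conj_neg_conj_neg_conj_self x (∼y) z
  rwa [neg_neg] at h

theorem conj_conj_self_conj (x y z : M) : x ⊙ (x ⊙ y ⊙ z) = x ⊙ (y ⊙ z) := by
  have h := conj_neg_conj_conj x ∼(x ⊙ y) z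
  rw [conj_neg_conj_self, neg_neg, conj_neg_conj_neg_conj_self] at h
  exact h.symm

theorem neg_conj_neg_conj_conj (x y z : M) :
    ∼(x ⊙ ∼y) ⊙ (y ⊙ z) = ∼(x ⊙ ff) ⊙ (y ⊙ z) := by
  rw [neg_conj_neg_conj, conj_conj_self, neg_neg_conj_conj_neg_neg_conj]

theorem conj_assoc (x y z : M) : x ⊙ y ⊙ z = x ⊙ (y ⊙ z) := by
  have h := neg_conj_neg_conj_conj (∼(x ⊙ ff)) (x ⊙ y) z
  rw [neg_neg_conj_ff_conj_neg_conj, neg_conj_ff, conj_ff_conj, conj_conj_self,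
    ← neg_conj_ff, ← neg_conj_neg_conj_conj, neg_neg_conj_neg_conj, conj_conj_self_conj] at h
  exact h

theorem neg_cond (x p q : M) :
    ∼(∼(x ⊙ p) ⊙ ∼(∼x ⊙ q)) = ∼(x ⊙ ∼p) ⊙ ∼(∼x ⊙ ∼q) := by
  rw [neg_conj_neg_conj, conj_conj_neg_neg_conj, conj_neg_conj_self, neg_neg]

theorem cond_conj (x p q r : M) :
    ∼(∼(x ⊙ p) ⊙ ∼(∼x ⊙ q)) ⊙ r = ∼(∼(x ⊙ (p ⊙ r)) ⊙ ∼(∼x ⊙ (q ⊙ r))) := by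
  rw [neg_cond, conj_assoc, neg_conj_neg_conj, conj_neg_conj_conj, neg_neg, ← conj_assoc p,
    ← conj_assoc x, conj_conj_neg_neg_conj, conj_assoc]

theorem conj_conj_conj_self (x y z : M) : x ⊙ (y ⊙ (x ⊙ z)) = x ⊙ (y ⊙ z) := by
  rw [← conj_assoc y, ← conj_assoc, conj_conj_left, conj_assoc]

theorem conj_neg_conj_conj_self (x y z : M) : x ⊙ ∼(y ⊙ (x ⊙ z)) = x ⊙ ∼(y ⊙ z) := by
  rw [← conj_neg_conj_self, conj_conj_conj_self, conj_neg_conj_self]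

theorem conj_neg_conj_left (x y z : M) : x ⊙ ∼(x ⊙ y ⊙ z) = x ⊙ ∼(y ⊙ z) := by
  rw [conj_assoc, conj_neg_conj_self]

theorem conj_cond (x y p q : M) :
    x ⊙ ∼(∼(y ⊙ (x ⊙ p)) ⊙ ∼(∼y ⊙ (x ⊙ q))) = x ⊙ ∼(∼(y ⊙ p) ⊙ ∼(∼y ⊙ q)) := by
  rw [← conj_neg_conj_conj_self, conj_neg_conj_conj_self x (∼y), conj_neg_conj_conj_self,
    ← conj_neg_conj_left, conj_neg_conj_conj_self, conj_neg_conj_left]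

/-! ### Conditionals -/

/-- The conditional on `x` with branches `p` and `q`, in terms of `⊼ₗ`. -/
def cond (x p q : M) : M := x ⊼ₗ p ⊼ₗ (x ⊼ₗ tt ⊼ₗ q)

theorem cond_eq (x p q : M) : cond x p q = ∼(∼(x ⊙ p) ⊙ ∼(∼x ⊙ q)) := by
  rw [← nand_eq, ← nand_eq, ← nand_eq]; rfl

theorem cond_tt_ff (x : M) : cond x tt ff = x := by
  rw [cond_eq, neg_conj_ff, conj_tt, neg_neg_conj_neg_conj]

theorem cond_nand (x p q r : M) : cond x p q ⊼ₗ r = cond x (p ⊼ₗ r) (q ⊼ₗ r) := by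
  rw [nand_eq, cond_eq, cond_eq, cond_conj, neg_cond, nand_eq, nand_eq]

theorem nand_cond_self (x p q : M) : x ⊼ₗ cond x p q = x ⊼ₗ p := by
  rw [nand_eq, cond_eq, conj_cond_self, nand_eq]

theorem neg_nand_cond_self (x p q : M) : ∼x ⊼ₗ cond x p q = ∼x ⊼ₗ q := by
  rw [nand_eq, cond_eq, neg_conj_cond_self, nand_eq]

theorem nand_cond (x y p q : M) : x ⊼ₗ cond y p q = x ⊼ₗ cond y ∼(x ⊼ₗ p) ∼(x ⊼ₗ q) := by
  rw [nand_eq, nand_eq x, cond_eq, cond_eq]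
  exact congrArg neg (conj_cond x y p q).symm

end SeqNand

open SeqNand

namespace NC

variable {A : Type}

/-- Derivable equality as a setoid on closed terms. -/
def derivSetoid (A : Type) : Setoid (NC A) :=
  ⟨NDeriv, .refl, .symm, .trans⟩

/-- Closed terms modulo derivable equality. -/
def Class (A : Type) : Type := Quotient (derivSetoid A)

/-- The class of a closed term. -/
def toClass (P : NC A) : Class A := Quotient.mk (derivSetoid A) P

theorem toClass_eq {P Q : NC A} : toClass P = toClass Q ↔ NDeriv P Q :=
  Quotient.eq (r := derivSetoid A)

instance : SeqNand (Class A) where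
  nand := Quotient.map₂ NC.nand fun _ _ h _ _ k => NDeriv.congr_nand h k
  tt := toClass NC.T
  absorb := by
    rintro ⟨x⟩ ⟨y⟩
    exact toClass_eq.2 (.ax_n2 x y)
  distrib := by
    rintro ⟨x⟩ ⟨y⟩ ⟨z⟩
    exact toClass_eq.2 (.ax_n3 x y z)

theorem toClass_T : toClass (NC.T : NC A) = tt := rfl

theorem toClass_F : toClass (NC.F : NC A) = ff := toClass_eq.2 .ax_n1

theorem toClass_nand (P Q : NC A) :
    toClass (NC.nand P Q) = SeqNand.nand (toClass P) (toClass Q) := rfl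

theorem toClass_U_nand (x : Class A) : SeqNand.nand (toClass NC.U) x = toClass NC.U := by
  obtain ⟨x⟩ := x
  exact toClass_eq.2 (.ax_nu x)

/-- The basic form with root `a` and branches `P` and `Q`. -/
def node (a : A) (P Q : NC A) : NC A :=
  NC.nand (NC.nand (NC.at_ a) P) (NC.nand (NC.nand (NC.at_ a) NC.T) Q)

theorem toClass_node (a : A) (P Q : NC A) :
    toClass (node a P Q) = cond (toClass (NC.at_ a)) (toClass P) (toClass Q) := rfl

theorem occurs_node {a b : A} {P Q : NC A} :
    occurs a (node b P Q) ↔ b = a ∨ occurs a P ∨ occurs a Q := by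
  simp only [node, occurs]
  tauto

end NC

section BasicForms

open NC

variable {A : Type}

/-- If `x` decides every conditional on `a`, then below `x` a basic form can be replaced by one
in which `a` does not occur. -/
theorem IsMUNBF.exists_not_occurs {a : A} {x : NC.Class A}
    (hx : (∀ p q, SeqNand.nand x (cond (toClass (NC.at_ a)) p q) = SeqNand.nand x p) ∨
      ∀ p q, SeqNand.nand x (cond (toClass (NC.at_ a)) p q) = SeqNand.nand x q)
    {R : NC A} (hR : IsMUNBF R) :
    ∃ R', IsMUNBF R' ∧ ¬ occurs a R' ∧ (∀ b, occurs b R' → occurs b R) ∧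
      SeqNand.nand x (toClass R) = SeqNand.nand x (toClass R') := by
  induction hR with
  | T => exact ⟨_, .T, id, fun _ => id, rfl⟩
  | F => exact ⟨_, .F, id, fun _ => id, rfl⟩
  | U => exact ⟨_, .U, id, fun _ => id, rfl⟩
  | @node b P Q hP hQ hbP hbQ ihP ihQ =>
    change ∃ R', IsMUNBF R' ∧ ¬ occurs a R' ∧ (∀ c, occurs c R' → occurs c (NC.node b P Q)) ∧
      SeqNand.nand x (toClass (NC.node b P Q)) = SeqNand.nand x (toClass R')
    by_cases hba : b = a
    · subst hba
      rcases hx with hx | hx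
      · exact ⟨P, hP, hbP, fun c hc => occurs_node.2 (.inr (.inl hc)), hx (toClass P) (toClass Q)⟩
      · exact ⟨Q, hQ, hbQ, fun c hc => occurs_node.2 (.inr (.inr hc)), hx (toClass P) (toClass Q)⟩
    · obtain ⟨P', hP', haP, hsP, heP⟩ := ihP
      obtain ⟨Q', hQ', haQ, hsQ, heQ⟩ := ihQ
      refine ⟨NC.node b P' Q', .node b hP' hQ' (hbP ∘ hsP b) (hbQ ∘ hsQ b), ?_, fun c => ?_, ?_⟩
      · simp [occurs_node, hba, haP, haQ]
      · simp only [occurs_node]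
        exact Or.imp_right (Or.imp (hsP c) (hsQ c))
      · rw [toClass_node, toClass_node, nand_cond, heP, heQ, ← nand_cond]

/-- A conditional on an atom between basic forms has a basic form. -/
theorem IsMUNBF.exists_cond (a : A) {P Q : NC A} (hP : IsMUNBF P) (hQ : IsMUNBF Q) :
    ∃ R, IsMUNBF R ∧ toClass R = cond (toClass (NC.at_ a)) (toClass P) (toClass Q) := by
  obtain ⟨P', hP', haP, -, heP⟩ := hP.exists_not_occurs (.inl (nand_cond_self (toClass (.at_ a))))
  obtain ⟨Q', hQ', haQ, -, heQ⟩ :=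
    hQ.exists_not_occurs (.inr (neg_nand_cond_self (toClass (.at_ a))))
  refine ⟨_, .node a hP' hQ' haP haQ, ?_⟩
  exact (congrArg₂ SeqNand.nand heP heQ).symm

theorem IsMUNBF.exists_nand_T {P : NC A} (hP : IsMUNBF P) :
    ∃ R, IsMUNBF R ∧ toClass R = SeqNand.nand (toClass P) tt := by
  induction hP with
  | T => exact ⟨_, .F, toClass_F⟩
  | F => exact ⟨_, .T, by rw [toClass_F, ff_nand, toClass_T]⟩
  | U => exact ⟨_, .U, (toClass_U_nand _).symm⟩
  | @node a P Q _ _ _ _ ihP ihQ =>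
    obtain ⟨R, hR, heR⟩ := ihP
    obtain ⟨S, hS, heS⟩ := ihQ
    obtain ⟨N, hN, heN⟩ := hR.exists_cond a hS
    exact ⟨N, hN, by rw [heN, heR, heS, ← cond_nand]; rfl⟩

theorem IsMUNBF.exists_nand {P Q : NC A} (hP : IsMUNBF P) (hQ : IsMUNBF Q) :
    ∃ R, IsMUNBF R ∧ toClass R = SeqNand.nand (toClass P) (toClass Q) := by
  induction hP with
  | T =>
    rw [toClass_T, tt_nand]
    exact hQ.exists_nand_T
  | F => exact ⟨_, .T, by rw [toClass_F, ff_nand, toClass_T]⟩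
  | U => exact ⟨_, .U, (toClass_U_nand _).symm⟩
  | @node a P₁ P₂ _ _ _ _ ih₁ ih₂ =>
    obtain ⟨R, hR, heR⟩ := ih₁
    obtain ⟨S, hS, heS⟩ := ih₂
    obtain ⟨N, hN, heN⟩ := hR.exists_cond a hS
    exact ⟨N, hN, by rw [heN, heR, heS, ← cond_nand]; rfl⟩

theorem exists_isMUNBF_toClass_eq (P : NC A) : ∃ Q, IsMUNBF Q ∧ toClass Q = toClass P := by
  induction P with
  | T => exact ⟨_, .T, rfl⟩
  | F => exact ⟨_, .F, rfl⟩
  | U => exact ⟨_, .U, rfl⟩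
  | at_ a =>
    exact ⟨_, .node a .T .F id id, by
      rw [← NC.node, toClass_node, toClass_F, toClass_T, cond_tt_ff]⟩
  | nand P Q ihP ihQ =>
    obtain ⟨R, hR, heR⟩ := ihP
    obtain ⟨S, hS, heS⟩ := ihQ
    obtain ⟨N, hN, heN⟩ := hR.exists_nand hS
    exact ⟨N, hN, by rw [heN, heR, heS, toClass_nand]⟩

end BasicForms

/-- For every closed term P there is a memorising U-nand basic form Q with
EqMSCLℓN^U ⊢ P = Q. -/
theorem exists_munbf {A : Type} [DecidableEq A] (P : NC A) :
    ∃ Q : NC A, IsMUNBF Q ∧ NDeriv P Q := by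
  obtain ⟨Q, hQ, h⟩ := exists_isMUNBF_toClass_eq P
  exact ⟨Q, hQ, NC.toClass_eq.1 h.symm⟩
end
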